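/- Let μ=(p_n)_n be an unbounded sequence of positive integers. The set 𝒰_{1−z}^μ(𝔻) of functions f ∈ H(𝔻) such that for every compact set K ⊂ ℂ ∖ (𝔻 ∪ {1}) with connected complement and every h ∈ A(K), there is a subsequence (λ_n)_n of μ with: a) f ∈ 𝒩_{λ_n,1} for all n; b) [f; λ_n/1] → h in A(K) as n → ∞; c) [f; λ_n/1] → f in H(𝔻) as n → ∞; d) the Padé denominator Q_{λ_n,1}(f)(z) = 1 − z for all n; is a dense and meagre subset of H(𝔻). In particular such a function f exists. -/

import Mathlib

open Polynomial Filter Finset Metric Topology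

noncomputable section

/-- Coefficient sequence extended to integer indices, with `a k = 0` for `k < 0`. -/
def acoefZ (a : ℕ → ℂ) (k : ℤ) : ℂ := if 0 ≤ k then a k.toNat else 0

/-- The Hankel determinant `C_{m,n} = det (a_{m-n+1+i+j})_{0 ≤ i,j ≤ n-1}`. -/
def hankelDet (a : ℕ → ℂ) (m n : ℕ) : ℂ :=
  Matrix.det (Matrix.of fun i j : Fin n => acoefZ a ((m : ℤ) - n + 1 + i + j))

/-- `IsPade a m n P Q` : the rational function `P/Q` is the Padé approximant of type
`(m,n)` of the formal power series `∑ a_k z^k`. -/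
def IsPade (a : ℕ → ℂ) (m n : ℕ) (P Q : Polynomial ℂ) : Prop :=
  P.natDegree ≤ m ∧ Q.natDegree ≤ n ∧ IsCoprime P Q ∧ Q.coeff 0 = 1 ∧
    ∀ j ≤ m + n, (∑ i ∈ Finset.range (j + 1), Q.coeff i * a (j - i)) = P.coeff j

/-- `𝒟_{m,n}` : the set of coefficient sequences whose Hankel determinant `C_{m,n}`
does not vanish. -/
def Dset (m n : ℕ) : Set (ℕ → ℂ) := {a | hankelDet a m n ≠ 0}

/-- `𝒩_{m,n}` : the subset of `𝒟_{m,n}` of series whose Padé denominator has exact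
degree `n`. -/
def Nset (m n : ℕ) : Set (ℕ → ℂ) :=
  {a | hankelDet a m n ≠ 0 ∧
    ∃ P Q : Polynomial ℂ, IsPade a m n P Q ∧ Q.degree = (n : WithBot ℕ)}

/-- The open unit disc in `ℂ`. -/
def unitD : Set ℂ := Metric.ball (0 : ℂ) 1

/-- The submodule of `ℂ → ℂ` of functions holomorphic on `Ω` (normalized to vanish
outside `Ω`, so that a function is determined by its restriction to `Ω`). -/
def holSubmodule (Ω : Set ℂ) : Submodule ℂ (ℂ → ℂ) where
  carrier := {f | DifferentiableOn ℂ f Ω ∧ ∀ z ∉ Ω, f z = 0}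
  add_mem' := fun hf hg => ⟨hf.1.add hg.1, fun z hz => by simp [hf.2 z hz, hg.2 z hz]⟩
  zero_mem' := ⟨differentiableOn_const 0, fun _ _ => rfl⟩
  smul_mem' := fun c f hf => ⟨hf.1.const_smul c, fun z hz => by simp [hf.2 z hz]⟩

/-- `H(Ω)`, the space of holomorphic functions on `Ω`. -/
abbrev Hol (Ω : Set ℂ) := ↥(holSubmodule Ω)

/-- The topology of uniform convergence on compact subsets of `Ω` on `H(Ω)`. -/
instance holTop (Ω : Set ℂ) : TopologicalSpace (Hol Ω) :=
  TopologicalSpace.induced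
    (fun f : Hol Ω => UniformOnFun.ofFun {K : Set Ω | IsCompact K} fun z : Ω => f.1 z)
    inferInstance

/-- The `k`-th Taylor coefficient at `0` of a function `f`. -/
def tc (f : ℂ → ℂ) (k : ℕ) : ℂ := iteratedDeriv k f 0 / k.factorial

/-- `𝒰_Q^μ(𝔻)` : the set of `f ∈ H(𝔻)` such that for every compact `K` avoiding
`𝔻 ∪ E` with connected complement, and every `h ∈ A(K)`, some subsequence
`(λ_n) = (μ (σ n))` of `μ` satisfies : a) `f ∈ 𝒩_{λ_n,q}`; b) `[f; λ_n/q] → h` in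
`A(K)`; c) `[f; λ_n/q] → f` in `H(𝔻)`; d) the Padé denominator `Q_{λ_n,q}(f)` equals
the prescribed polynomial `Qp`. -/
def UQset (μ : ℕ → ℕ) (q : ℕ) (Qp : Polynomial ℂ) (E : Set ℂ) : Set (Hol unitD) :=
  {f | ∀ K : Set ℂ, IsCompact K → Disjoint K (unitD ∪ E) → IsConnected Kᶜ →
    ∀ h : ℂ → ℂ, ContinuousOn h K → DifferentiableOn ℂ h (interior K) →
    ∃ σ : ℕ → ℕ, StrictMono σ ∧ ∃ P : ℕ → Polynomial ℂ,
      (∀ k, tc f.1 ∈ Nset (μ (σ k)) q ∧ IsPade (tc f.1) (μ (σ k)) q (P k) Qp) ∧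
      TendstoUniformlyOn (fun k z => (P k).eval z / Qp.eval z) h atTop K ∧
      TendstoLocallyUniformlyOn (fun k z => (P k).eval z / Qp.eval z) f.1 atTop unitD}

/-- The uniform closure of the polynomials in the continuous functions on `K`. -/
def polyClosure (K : Set ℂ) [CompactSpace K] : Subalgebra ℂ C(K, ℂ) :=
  (polynomialFunctions K).topologicalClosure

lemma isClosed_polyClosure (K : Set ℂ) [CompactSpace K] :
    IsClosed (polyClosure K : Set C(K, ℂ)) :=
  Subalgebra.isClosed_topologicalClosure _

instance (K : Set ℂ) [CompactSpace K] : IsClosed (polyClosure K : Set C(K, ℂ)) :=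
  isClosed_polyClosure K

instance (K : Set ℂ) [CompactSpace K] : CompleteSpace (polyClosure K) :=
  (isClosed_polyClosure K).completeSpace_coe

lemma toContinuousMapOn_mem_polyClosure (K : Set ℂ) [CompactSpace K] (p : ℂ[X]) :
    p.toContinuousMapOn K ∈ polyClosure K :=
  Subalgebra.le_topologicalClosure _ ⟨p, trivial, rfl⟩

lemma exists_polynomial_of_mem_polyClosure {K : Set ℂ} [CompactSpace K] {f : C(K, ℂ)}
    (hf : f ∈ polyClosure K) {ε : ℝ} (hε : 0 < ε) :
    ∃ p : ℂ[X], ∀ z : K, ‖p.eval (z : ℂ) - f z‖ < ε := by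
  have hf' : f ∈ closure (polynomialFunctions K : Set C(K, ℂ)) := hf
  obtain ⟨g, ⟨p, -, rfl⟩, hg⟩ := Metric.mem_closure_iff.1 hf' ε hε
  refine ⟨p, fun z => ?_⟩
  rw [dist_comm, dist_eq_norm] at hg
  exact (ContinuousMap.norm_coe_le_norm (_ - f) z).trans_lt hg

lemma spectrum_X_polyClosure (K : Set ℂ) [CompactSpace K] (hK : IsPreconnected Kᶜ) :
    spectrum ℂ (⟨_, toContinuousMapOn_mem_polyClosure K X⟩ : polyClosure K) = K := by
  have h : spectrum ℂ (X.toContinuousMapOn K : C(K, ℂ)) = K := by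
    rw [ContinuousMap.spectrum_eq_range]
    ext z
    simp
  rw [Subalgebra.spectrum_eq_of_isPreconnected_compl (polyClosure K)]
  · exact h
  · change IsPreconnected (spectrum ℂ (X.toContinuousMapOn K : C(K, ℂ)))ᶜ
    rwa [h]

/-- A nowhere vanishing uniform limit of polynomials on a compact set with connected complement
is invertible among the uniform limits of polynomials. -/
lemma exists_mul_eq_one_of_mem_polyClosure {K : Set ℂ} [CompactSpace K]
    (hK : IsPreconnected Kᶜ) {f : C(K, ℂ)} (hf : f ∈ polyClosure K) (h0 : ∀ z, f z ≠ 0) :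
    ∃ g ∈ polyClosure K, ∀ z, f z * g z = 1 := by
  suffices h : IsUnit (⟨f, hf⟩ : polyClosure K) by
    obtain ⟨g, hg⟩ := h.exists_right_inv
    refine ⟨g, g.2, fun z => ?_⟩
    have := congrArg (fun x : polyClosure K => (x : C(K, ℂ)) z) hg
    simpa using this
  by_contra hu
  obtain ⟨φ, hφ⟩ := WeakDual.CharacterSpace.exists_apply_eq_zero hu
  set x : polyClosure K := ⟨_, toContinuousMapOn_mem_polyClosure K X⟩ with hx
  have hmem : φ x ∈ spectrum ℂ x := AlgHom.apply_mem_spectrum φ x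
  rw [spectrum_X_polyClosure K hK] at hmem
  have hpoly : ∀ p : ℂ[X], φ ⟨_, toContinuousMapOn_mem_polyClosure K p⟩ = p.eval (φ x) := by
    intro p
    have : (⟨_, toContinuousMapOn_mem_polyClosure K p⟩ : polyClosure K) = aeval x p := by
      apply Subtype.ext
      ext z
      have h1 : ((aeval x p : polyClosure K) : C(K, ℂ)) = aeval (x : C(K, ℂ)) p :=
        (Polynomial.aeval_algHom_apply (polyClosure K).val x p).symm
      have h2 : (aeval (x : C(K, ℂ)) p : C(K, ℂ)) z = aeval ((x : C(K, ℂ)) z) p :=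
        (Polynomial.aeval_algHom_apply (ContinuousMap.evalAlgHom ℂ ℂ z) (x : C(K, ℂ)) p).symm
      rw [h1, h2]
      have h3 : (x : C(K, ℂ)) z = z := by simp [hx]
      rw [h3, Polynomial.coe_aeval_eq_eval]
      rfl
    rw [this]
    have := Polynomial.aeval_algHom_apply (WeakDual.CharacterSpace.toAlgHom φ) x p
    rw [← Polynomial.coe_aeval_eq_eval]
    exact this.symm
  apply h0 ⟨φ x, hmem⟩
  by_contra hne
  obtain ⟨c, hc0, hc⟩ : ∃ c : ℝ, 0 < c ∧ ∀ g : polyClosure K, ‖φ g‖ ≤ c * ‖g‖ := by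
    obtain ⟨c, hc0, hc⟩ := (WeakDual.CharacterSpace.toCLM φ).isBoundedLinearMap.bound
    exact ⟨c, hc0, hc⟩
  have hpos : 0 < ‖f ⟨φ x, hmem⟩‖ := norm_pos_iff.2 hne
  have hf' : f ∈ closure (polynomialFunctions K : Set C(K, ℂ)) := hf
  obtain ⟨g, ⟨p, -, rfl⟩, hg⟩ := Metric.mem_closure_iff.1 hf' (‖f ⟨φ x, hmem⟩‖ / (c + 1))
    (by positivity)
  have h1 : ‖f ⟨φ x, hmem⟩ - p.eval (φ x)‖ ≤ dist f (p.toContinuousMapOn K) := by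
    rw [dist_eq_norm]
    exact ContinuousMap.norm_coe_le_norm (f - p.toContinuousMapOn K) ⟨φ x, hmem⟩
  have h2 : ‖p.eval (φ x)‖ ≤ c * dist f (p.toContinuousMapOn K) := by
    have := hc (⟨_, toContinuousMapOn_mem_polyClosure K p⟩ - ⟨f, hf⟩)
    rw [map_sub, hφ, sub_zero, hpoly] at this
    rw [dist_comm, dist_eq_norm]
    exact this
  have h3 : ‖f ⟨φ x, hmem⟩‖ ≤ (c + 1) * dist f (p.toContinuousMapOn K) := by
    have := norm_sub_norm_le (f ⟨φ x, hmem⟩) (p.eval (φ x))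
    linarith
  rw [lt_div_iff₀ (by positivity)] at hg
  have hg' : dist f (p.toContinuousMapOn K) * (c + 1) < ‖f ⟨φ x, hmem⟩‖ := hg
  linarith

/-- Near `1`, square roots exist among the uniform limits of polynomials. -/
lemma exists_sq_eq_one_add {K : Set ℂ} [CompactSpace K] {u : C(K, ℂ)} (hu : u ∈ polyClosure K)
    (h1 : ∀ z, ‖u z‖ < 1) :
    ∃ t ∈ polyClosure K, ∀ z, t z ^ 2 = 1 + u z ∧ |(t z).im| < (t z).re := by
  set F : ℂ → ℂ := fun w => (1 + w) ^ ((2 : ℂ)⁻¹) with hF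
  have hre : ∀ w : ℂ, ‖w‖ < 1 → 0 < (1 + w).re := fun w hw => by
    have := (abs_lt.1 ((Complex.abs_re_le_norm w).trans_lt hw)).1
    simp; linarith
  have hd : DifferentiableOn ℂ F (ball 0 1) := by
    intro w hw
    have : (1 + w) ∈ Complex.slitPlane := Or.inl (hre w (by simpa using hw))
    exact ((differentiableAt_id.const_add 1).cpow_const this).differentiableWithinAt
  obtain ⟨q, hq1, hq⟩ : ∃ q : ℝ, q < 1 ∧ ∀ z, ‖u z‖ < q := by
    rcases isEmpty_or_nonempty K with hE | hE
    · exact ⟨0, one_pos, fun z => (hE.false z).elim⟩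
    · obtain ⟨z0, -, hz0⟩ := isCompact_univ.exists_isMaxOn Set.univ_nonempty
        (u.continuous.norm.continuousOn)
      obtain ⟨q, hq, hq1⟩ := exists_between (h1 z0)
      exact ⟨q, hq1, fun z => (hz0 (Set.mem_univ z)).trans_lt hq⟩
  let t : C(K, ℂ) := ⟨fun z => F (u z), by
    refine hd.continuousOn.comp_continuous u.continuous fun z => by simpa using h1 z⟩
  refine ⟨t, ?_, fun z => ?_⟩
  · rcases isEmpty_or_nonempty K with hE | ⟨⟨z0⟩⟩
    · convert (polyClosure K).zero_mem
      ext z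
      exact (hE.false z).elim
    have hq0 : 0 < q := (norm_nonneg _).trans_lt (hq z0)
    lift q to NNReal using hq0.le
    obtain ⟨r, hqr, hr1⟩ := exists_between hq1
    lift r to NNReal using (hq0.trans hqr).le
    have hp : HasFPowerSeriesOnBall F (cauchyPowerSeries F 0 r) 0 r :=
      (hd.mono (closedBall_subset_ball hr1)).hasFPowerSeriesOnBall (by exact_mod_cast hq0.trans hqr)
    have hun := hp.tendstoUniformlyOn (r' := q) (by exact_mod_cast hqr)
    let T : ℕ → C(K, ℂ) := fun n => ∑ k ∈ range n, (cauchyPowerSeries F 0 r).coeff k • u ^ k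
    have hT : ∀ n, T n ∈ polyClosure K := fun n =>
      Subalgebra.sum_mem _ fun k _ => Subalgebra.smul_mem _ (Subalgebra.pow_mem _ hu k) _
    refine (isClosed_polyClosure K).mem_of_tendsto (f := T) (b := atTop) ?_
      (Eventually.of_forall hT)
    rw [ContinuousMap.tendsto_iff_tendstoUniformly, Metric.tendstoUniformly_iff]
    intro ε hε
    filter_upwards [Metric.tendstoUniformlyOn_iff.1 hun ε hε] with n hn z
    have := hn (u z) (by simpa using hq z)
    simpa [T, t, FormalMultilinearSeries.partialSum, FormalMultilinearSeries.coeff_eq_zero,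
      FormalMultilinearSeries.apply_eq_pow_smul_coeff, mul_comm] using this
  · have hsq : t z ^ 2 = 1 + u z := by
      simp [t, hF]
    have hne : (1 + u z) ≠ 0 := fun h => by
      have := hre _ (h1 z)
      rw [h] at this
      simp at this
    have hpos : 0 ≤ (t z).re := by
      have h : t z = Complex.exp (Complex.log (1 + u z) * 2⁻¹) := by
        simp [t, hF, Complex.cpow_def_of_ne_zero hne]
      have h2 : (Complex.log (1 + u z) * 2⁻¹).im = Complex.arg (1 + u z) / 2 := by
        have : ((2 : ℂ)⁻¹) = ((2⁻¹ : ℝ) : ℂ) := by push_cast; rfl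
        rw [this, Complex.im_mul_ofReal, Complex.log_im]; ring
      rw [h, Complex.exp_re, h2]
      have h3 := Complex.arg_le_pi (1 + u z)
      have h4 := Complex.neg_pi_lt_arg (1 + u z)
      exact mul_nonneg (Real.exp_pos _).le
        (Real.cos_nonneg_of_neg_pi_div_two_le_of_le (by linarith) (by linarith))
    refine ⟨hsq, ?_⟩
    have h5 := hre _ (h1 z)
    rw [← hsq, sq, Complex.mul_re] at h5
    rw [← abs_of_nonneg hpos]
    exact sq_lt_sq.1 (by nlinarith)

lemma exists_sqrt_quotient_step {K : Set ℂ} [CompactSpace K] (hK : IsPreconnected Kᶜ)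
    {a b c : ℂ} {r : ℝ} (hc : c ∉ K) (hcr : ‖c - a‖ < r)
    (hbc : ∀ z ∈ K, ‖b - c‖ < ‖z - c‖)
    (h : ∃ s ∈ polyClosure K, ∀ z : K, s z ^ 2 * (z - b) = z - a ∧
      (r ≤ ‖(z : ℂ) - a‖ → |(s z).im| < (s z).re)) :
    ∃ s ∈ polyClosure K, ∀ z : K, s z ^ 2 * (z - c) = z - a ∧
      (r ≤ ‖(z : ℂ) - a‖ → |(s z).im| < (s z).re) := by
  obtain ⟨s, hs, hsz⟩ := h
  have hne : ∀ z : K, (z : ℂ) - c ≠ 0 := fun z hz => hc (sub_eq_zero.1 hz ▸ z.2)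
  obtain ⟨g, hg, hgz⟩ := exists_mul_eq_one_of_mem_polyClosure hK
    (toContinuousMapOn_mem_polyClosure K (X - C c)) (fun z => by simpa using hne z)
  have hgz' : ∀ z : K, g z = ((z : ℂ) - c)⁻¹ := fun z => by
    have := hgz z
    simp at this
    exact eq_inv_of_mul_eq_one_right this
  obtain ⟨t, ht, htz⟩ := exists_sq_eq_one_add (u := (c - b) • g)
    (Subalgebra.smul_mem _ hg _) (fun z => by
      have h1 := hbc z z.2
      have h2 : 0 < ‖(z : ℂ) - c‖ := (norm_nonneg _).trans_lt h1
      simp only [ContinuousMap.smul_apply, hgz' z, smul_eq_mul, norm_mul, norm_inv]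
      rw [← div_eq_mul_inv, div_lt_one h2, norm_sub_rev]
      exact h1)
  refine ⟨s * t, Subalgebra.mul_mem _ hs ht, fun z => ?_⟩
  have hsq : (s z * t z) ^ 2 * (z - c) = z - a := by
    have h1 := (htz z).1
    simp only [ContinuousMap.smul_apply, hgz' z, smul_eq_mul] at h1
    have h2 : t z ^ 2 * (z - c) = z - b := by
      rw [h1]
      field_simp [hne z]
      ring
    rw [mul_pow, mul_assoc, h2]
    exact (hsz z).1
  refine ⟨hsq, fun hr => ?_⟩
  have hs1 := (hsz z).2 hr
  have ht1 := (htz z).2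
  rw [ContinuousMap.mul_apply]
  set w := s z * t z with hw
  have hwre : 0 < w.re := by
    rw [hw, Complex.mul_re]
    rw [abs_lt] at hs1 ht1
    nlinarith
  rw [← abs_of_pos hwre]
  refine sq_lt_sq.1 ?_
  have hza : 0 < ‖(z : ℂ) - a‖ := (norm_nonneg _).trans_lt (hcr.trans_le hr)
  have hza' : (z : ℂ) - a ≠ 0 := norm_pos_iff.1 hza
  have h3 : (w ^ 2) * (1 - (c - a) / (z - a)) = 1 := by
    have : (1 - (c - a) / (z - a)) = (z - c) / (z - a) := by field_simp; ring
    rw [this, mul_div_assoc', hsq, div_self hza']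
  have h4 : 0 < (1 - (c - a) / (z - a)).re := by
    have h5 : ‖(c - a) / (z - a)‖ < 1 := by
      rw [norm_div, div_lt_one hza]
      exact hcr.trans_le hr
    have := (abs_lt.1 ((Complex.abs_re_le_norm _).trans_lt h5)).2
    rw [Complex.sub_re, Complex.one_re]
    linarith
  have h6 : 0 < (w ^ 2).re := by
    rw [eq_inv_of_mul_eq_one_left h3, Complex.inv_re]
    refine div_pos h4 (Complex.normSq_pos.2 fun h => ?_)
    rw [h] at h4
    simp at h4
  rw [sq, Complex.mul_re] at h6
  nlinarith

/-- The function `√((z - a) / (z - b))` is a uniform limit of polynomials on `K` when `a` and `b`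
can be joined in the complement of `K`. -/
lemma exists_sqrt_quotient {K : Set ℂ} [CompactSpace K] (hK : IsPreconnected Kᶜ)
    {a b : ℂ} {r : ℝ} {U : Set ℂ} (hU : IsPreconnected U) (hUK : U ⊆ Kᶜ) (hUr : U ⊆ ball a r)
    (ha : a ∈ U) (hb : b ∈ U) :
    ∃ s ∈ polyClosure K, ∀ z : K, s z ^ 2 * (z - b) = z - a ∧
      (r ≤ ‖(z : ℂ) - a‖ → |(s z).im| < (s z).re) := by
  let P : ℂ → Prop := fun b => ∃ s ∈ polyClosure K, ∀ z : K, s z ^ 2 * (z - b) = z - a ∧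
      (r ≤ ‖(z : ℂ) - a‖ → |(s z).im| < (s z).re)
  have hKc : IsClosed K := (isCompact_iff_compactSpace.2 ‹_›).isClosed
  have hmain : P a ↔ P b := by
    refine hU.induction₂ (fun x y => P x ↔ P y) (fun x hx => ?_)
      (fun x y z _ _ _ h1 h2 => h1.trans h2) (fun x y _ _ h => h.symm) ha hb
    obtain ⟨ε, hε, hball⟩ := Metric.isOpen_iff.1 hKc.isOpen_compl x (hUK hx)
    filter_upwards [self_mem_nhdsWithin, mem_nhdsWithin_of_mem_nhds
      (Metric.ball_mem_nhds x (half_pos hε))] with y hy hxy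
    have hd : ∀ z ∈ K, ε ≤ ‖z - x‖ := fun z hz => by
      by_contra! h
      exact hball (mem_ball_iff_norm.2 h) hz
    rw [mem_ball_iff_norm] at hxy
    refine ⟨exists_sqrt_quotient_step hK (hUK hy) (mem_ball_iff_norm.1 (hUr hy)) ?_,
      exists_sqrt_quotient_step hK (hUK hx) (mem_ball_iff_norm.1 (hUr hx)) ?_⟩
    · intro z hz
      have h1 := norm_sub_le_norm_sub_add_norm_sub z y x
      have h2 := hd z hz
      rw [norm_sub_rev]
      linarith
    · intro z hz
      have h2 := hd z hz
      linarith
  refine hmain.1 ⟨1, Subalgebra.one_mem _, fun z => by simp⟩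

/-- An unbounded connected open set reaches far away from each of its points, already within a
given disc. -/
lemma exists_mem_connectedComponentIn_ball {V : Set ℂ} (hV : IsPreconnected V) (hVo : IsOpen V)
    (hVb : ¬ Bornology.IsBounded V) {a : ℂ} (ha : a ∈ V) {r : ℝ} (hr : 0 < r) :
    ∃ b ∈ connectedComponentIn (V ∩ ball a r) a, r / 2 ≤ ‖b - a‖ := by
  by_contra! h
  set U := connectedComponentIn (V ∩ ball a r) a with hU
  have haU : a ∈ U := mem_connectedComponentIn ⟨ha, mem_ball_self hr⟩
  have hUo : IsOpen U := (hVo.inter isOpen_ball).connectedComponentIn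
  have hUV : U ⊆ V ∩ ball a r := connectedComponentIn_subset _ _
  have hsub : V ⊆ U := by
    refine hV.subset_of_closure_inter_subset hUo ⟨a, ha, haU⟩ ?_
    rintro x ⟨hx, hxV⟩
    have hxb : x ∈ closedBall a (r / 2) :=
      closure_minimal (fun y hy => mem_closedBall_iff_norm.2 (h y hy).le) isClosed_closedBall hx
    have hxr : x ∈ V ∩ ball a r := ⟨hxV, closedBall_subset_ball (by linarith) hxb⟩
    have hpre : IsPreconnected (insert x U) :=
      isPreconnected_connectedComponentIn.subset_closure (Set.subset_insert _ _)
        (Set.insert_subset hx subset_closure)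
    exact hpre.subset_connectedComponentIn (Set.mem_insert_of_mem _ haU)
      (Set.insert_subset hxr hUV) (Set.mem_insert _ _)
  exact hVb (isBounded_ball.subset (hsub.trans (hUV.trans Set.inter_subset_right)))

/-- The Cauchy kernel `1 / (z - ζ)`, for `ζ` near a point off `K`, is approximated to third order
by uniform limits of polynomials on `K`, with universal constants. -/
lemma exists_cauchy_kernel_approx {K : Set ℂ} [CompactSpace K] (hK : IsPreconnected Kᶜ)
    {a : ℂ} (ha : a ∉ K) {r : ℝ} (hr : 0 < r) :
    ∃ m : ℂ, ∃ g ∈ polyClosure K, ∀ z : K, ∀ ζ ∈ ball a r, (z : ℂ) ≠ ζ →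
      ‖g z + (ζ - m) * g z ^ 2 - (z - ζ)⁻¹‖ ≤
        10 ^ 8 * (r ^ 2 / (‖z - ζ‖ * (‖z - ζ‖ ^ 2 + r ^ 2))) := by
  have hKc : IsCompact K := isCompact_iff_compactSpace.2 ‹_›
  have hunb : ¬ Bornology.IsBounded Kᶜ := fun h => by
    have := hKc.isBounded.union h
    rw [Set.union_compl_self] at this
    exact NormedSpace.unbounded_univ ℂ ℂ this
  obtain ⟨b, hbU, hb⟩ := exists_mem_connectedComponentIn_ball hK hKc.isClosed.isOpen_compl hunb ha hr
  have hsub := connectedComponentIn_subset (Kᶜ ∩ ball a r) a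
  obtain ⟨s, hs, hsz⟩ := exists_sqrt_quotient hK (isPreconnected_connectedComponentIn)
    (hsub.trans Set.inter_subset_left) (hsub.trans Set.inter_subset_right)
    (mem_connectedComponentIn ⟨ha, mem_ball_self hr⟩) hbU
  have hbr : ‖b - a‖ < r := mem_ball_iff_norm.1 (hsub hbU).2
  have hlow : ∀ z : K, 1 / 10 ≤ ‖s z + 1‖ := by
    intro z
    by_cases hz : r ≤ ‖(z : ℂ) - a‖
    · have h1 := (abs_nonneg _).trans_lt ((hsz z).2 hz)
      have h2 := Complex.re_le_norm (s z + 1)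
      simp at h2
      linarith
    · push Not at hz
      by_contra! h
      have h1 : (s z - 1) * (s z + 1) * (z - b) = b - a := by linear_combination (hsz z).1
      have h2 : ‖s z - 1‖ ≤ ‖s z + 1‖ + 2 := by
        calc ‖s z - 1‖ = ‖(s z + 1) - 2‖ := by ring_nf
          _ ≤ _ := (norm_sub_le _ _).trans (by simp)
      have h3 : ‖(z : ℂ) - b‖ ≤ 2 * r := by
        have := norm_sub_le_norm_sub_add_norm_sub (z : ℂ) a b
        rw [norm_sub_rev a b] at this
        linarith
      have h4 : ‖b - a‖ ≤ (21 / 10) * (1 / 10) * (2 * r) := by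
        rw [← h1, norm_mul, norm_mul]
        gcongr
        linarith
      linarith
  obtain ⟨y, hy, hyz⟩ := exists_mul_eq_one_of_mem_polyClosure hK
    (Subalgebra.add_mem _ hs (Subalgebra.one_mem _)) (fun z hz => by
      have := hlow z
      rw [ContinuousMap.add_apply, ContinuousMap.one_apply] at hz
      rw [hz] at this
      norm_num at this)
  set e := b - a with he
  have he0 : e ≠ 0 := norm_pos_iff.1 (by linarith)
  refine ⟨a + e / 2, (4 / e) • (1 - (2 : ℂ) • y), Subalgebra.smul_mem _ (Subalgebra.sub_mem _
    (Subalgebra.one_mem _) (Subalgebra.smul_mem _ hy _)) _, fun z ζ hζ hne => ?_⟩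
  have hy1 : (s z + 1) * y z = 1 := hyz z
  have hyn : ‖y z‖ ≤ 10 := by
    have h1 : ‖s z + 1‖ * ‖y z‖ = 1 := by rw [← norm_mul, hy1, norm_one]
    have := hlow z
    nlinarith [norm_nonneg (y z)]
  set g : ℂ := ((4 / e) • (1 - (2 : ℂ) • y)) z with hg
  have hg' : g = 4 / e * (1 - 2 * y z) := by simp [hg]
  set Z : ℂ := z - (a + e / 2) with hZ
  have hJ : Z * g = 1 + e ^ 2 / 16 * g ^ 2 := by
    have h1 : (1 - 2 * y z) * (z - b) = y z ^ 2 * e := by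
      have h2 := (hsz z).1
      linear_combination (y z ^ 2) * h2 - (s z * y z + 1 - y z) * (z - b) * hy1
    rw [hg', hZ]
    field_simp
    rw [he] at h1 ⊢
    linear_combination 128 * h1
  have hgn : ‖g‖ ≤ 168 / r := by
    have h1 : ‖(1 : ℂ) - 2 * y z‖ ≤ 21 := by
      refine (norm_sub_le _ _).trans ?_
      rw [norm_mul]
      norm_num
      linarith
    have h2 : ‖4 / e‖ ≤ 8 / r := by
      rw [norm_div, div_le_div_iff₀ (norm_pos_iff.2 he0) hr]
      norm_num
      linarith
    calc ‖g‖ = ‖4 / e‖ * ‖(1 : ℂ) - 2 * y z‖ := by rw [hg', norm_mul]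
      _ ≤ 8 / r * 21 := by gcongr
      _ = 168 / r := by ring
  set η : ℂ := ζ - (a + e / 2) with hη
  have hηn : ‖η‖ ≤ 3 / 2 * r := by
    have h1 : ‖e / 2‖ ≤ r / 2 := by
      rw [norm_div]
      norm_num
      linarith
    have h2 := mem_ball_iff_norm.1 hζ
    calc ‖η‖ = ‖(ζ - a) - e / 2‖ := by rw [hη]; ring_nf
      _ ≤ ‖ζ - a‖ + ‖e / 2‖ := norm_sub_le _ _
      _ ≤ 3 / 2 * r := by linarith
  have hw : (z : ℂ) - ζ ≠ 0 := sub_ne_zero.2 hne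
  have hκn : ‖e ^ 2 / 16‖ ≤ r ^ 2 / 16 := by
    rw [norm_div, norm_pow]
    norm_num
    gcongr
  set κ : ℂ := e ^ 2 / 16 with hκ
  have hform : g + η * g ^ 2 - (z - ζ)⁻¹ = g ^ 2 * (κ + κ * η * g - η ^ 2) * (z - ζ)⁻¹ := by
    have hZη : (z : ℂ) - ζ = Z - η := by rw [hZ, hη]; ring
    rw [hZη] at hw ⊢
    field_simp
    linear_combination (1 + η * g) * hJ
  have hgr : ‖g‖ * r ≤ 168 := by
    rwa [le_div_iff₀ hr] at hgn
  have hbr2 : ‖κ + κ * η * g - η ^ 2‖ ≤ 19 * r ^ 2 := by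
    have h1 : ‖κ * η * g‖ ≤ r ^ 2 / 16 * (3 / 2 * r) * (168 / r) := by
      rw [norm_mul, norm_mul]
      gcongr
    have h2 : r ^ 2 / 16 * (3 / 2 * r) * (168 / r) = 63 / 4 * r ^ 2 := by
      field_simp; ring
    have h3 : ‖η ^ 2‖ ≤ (3 / 2 * r) ^ 2 := by
      rw [norm_pow]
      gcongr
    calc ‖κ + κ * η * g - η ^ 2‖ ≤ ‖κ‖ + ‖κ * η * g‖ + ‖η ^ 2‖ :=
          (norm_sub_le _ _).trans (by gcongr; exact norm_add_le _ _)
      _ ≤ 19 * r ^ 2 := by nlinarith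
  have hgw : ‖g‖ * ‖(z : ℂ) - ζ‖ ≤ 2017 := by
    have h1 : ‖κ * g ^ 2‖ ≤ 1764 := by
      rw [norm_mul, norm_pow]
      calc ‖κ‖ * ‖g‖ ^ 2 ≤ r ^ 2 / 16 * ‖g‖ ^ 2 := by gcongr
        _ = (‖g‖ * r) ^ 2 / 16 := by ring
        _ ≤ 168 ^ 2 / 16 := by gcongr
        _ ≤ 1764 := by norm_num
    have h2 : ‖η * g‖ ≤ 252 := by
      rw [norm_mul]
      calc ‖η‖ * ‖g‖ ≤ (3 / 2 * r) * ‖g‖ := by gcongr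
        _ = 3 / 2 * (‖g‖ * r) := by ring
        _ ≤ 252 := by linarith
    have h3 : g * (z - ζ) = 1 + κ * g ^ 2 - η * g := by
      rw [← hJ, hZ, hη]; ring
    rw [← norm_mul, h3]
    calc ‖1 + κ * g ^ 2 - η * g‖ ≤ ‖(1 : ℂ)‖ + ‖κ * g ^ 2‖ + ‖η * g‖ :=
          (norm_sub_le _ _).trans (by gcongr; exact norm_add_le _ _)
      _ ≤ 2017 := by rw [norm_one]; linarith
  have hwp : 0 < ‖(z : ℂ) - ζ‖ := norm_pos_iff.2 hw
  rw [hform, norm_mul, norm_mul, norm_pow, norm_inv]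
  set w := ‖(z : ℂ) - ζ‖ with hwdef
  have h4 : ‖g‖ ^ 2 * (w ^ 2 + r ^ 2) ≤ 5 * 10 ^ 6 := by
    have h5 : (‖g‖ * w) ^ 2 ≤ 2017 ^ 2 := by gcongr
    have h6 : (‖g‖ * r) ^ 2 ≤ 168 ^ 2 := by gcongr
    nlinarith
  calc ‖g‖ ^ 2 * ‖κ + κ * η * g - η ^ 2‖ * w⁻¹ ≤ ‖g‖ ^ 2 * (19 * r ^ 2) * w⁻¹ := by gcongr
    _ = (‖g‖ ^ 2 * (w ^ 2 + r ^ 2)) * 19 * (r ^ 2 / (w * (w ^ 2 + r ^ 2))) := by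
      field_simp
    _ ≤ (5 * 10 ^ 6) * 19 * (r ^ 2 / (w * (w ^ 2 + r ^ 2))) := by gcongr
    _ ≤ 10 ^ 8 * (r ^ 2 / (w * (w ^ 2 + r ^ 2))) := by gcongr; norm_num

section CauchyTransform

open MeasureTheory

/-- A radial majorant for the error of a third order approximation of the Cauchy kernel. -/
def errorKernel (r : ℝ) (w : ℂ) : ℝ := r ^ 2 / (‖w‖ * (‖w‖ ^ 2 + r ^ 2))

lemma errorKernel_nonneg (r : ℝ) (w : ℂ) : 0 ≤ errorKernel r w := by
  unfold errorKernel; positivity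

lemma mul_errorKernel_radial {r : ℝ} (hr : 0 < r) {y : ℝ} (hy : y ∈ Set.Ioi (0 : ℝ)) :
    y ^ (Module.finrank ℝ ℂ - 1) • (r ^ 2 / (y * (y ^ 2 + r ^ 2))) = (1 + (r⁻¹ * y) ^ 2)⁻¹ := by
  have hy' : y ≠ 0 := (Set.mem_Ioi.1 hy).ne'
  have h2 : y ^ 2 + r ^ 2 ≠ 0 := by positivity
  have h3 : 1 + (r⁻¹ * y) ^ 2 ≠ 0 := by positivity
  rw [Complex.finrank_real_complex, smul_eq_mul]
  field_simp
  ring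

lemma integrable_errorKernel {r : ℝ} (hr : 0 < r) : Integrable (errorKernel r) := by
  refine (integrable_fun_norm_addHaar (E := ℂ) volume
    (f := fun y => r ^ 2 / (y * (y ^ 2 + r ^ 2)))).2 ?_
  rw [integrableOn_congr_fun (fun y hy => mul_errorKernel_radial hr hy) measurableSet_Ioi]
  exact (integrable_inv_one_add_sq.comp_mul_left' (inv_ne_zero hr.ne')).integrableOn

lemma integral_errorKernel {r : ℝ} (hr : 0 < r) :
    ∫ w, errorKernel r w = Real.pi ^ 2 * r := by
  have h := integral_fun_norm_addHaar (E := ℂ) volume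
    (fun y => r ^ 2 / (y * (y ^ 2 + r ^ 2)))
  rw [setIntegral_congr_fun measurableSet_Ioi (fun y hy => mul_errorKernel_radial hr hy)] at h
  rw [integral_comp_mul_left_Ioi (fun y => (1 + y ^ 2)⁻¹) 0 (inv_pos.2 hr)] at h
  have hv : volume.real (ball (0 : ℂ) 1) = Real.pi := by
    simp [Measure.real, Complex.volume_ball]
  rw [hv] at h
  simp only [errorKernel, h, Complex.finrank_real_complex]
  simp
  ring

lemma integrableOn_inv_norm_sub (z : ℂ) (R : ℝ) :
    IntegrableOn (fun ζ : ℂ => ‖z - ζ‖⁻¹) (closedBall 0 R) := by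
  have h1 : Integrable (fun ζ => ((‖z‖ + |R|) ^ 2 + 1) * errorKernel 1 (z - ζ)) :=
    ((integrable_errorKernel one_pos).comp_sub_left z).const_mul _
  refine h1.integrableOn.mono' ?_ ?_
  · exact (by fun_prop : Measurable fun ζ : ℂ => ‖z - ζ‖⁻¹).aestronglyMeasurable
  · refine (ae_restrict_iff' measurableSet_closedBall).2 (Eventually.of_forall fun ζ hζ => ?_)
    have h2 : ‖z - ζ‖ ≤ ‖z‖ + |R| := by
      refine (norm_sub_le _ _).trans ?_
      gcongr
      exact (mem_closedBall_zero_iff.1 hζ).trans (le_abs_self R)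
    rw [norm_inv, norm_norm, errorKernel]
    rcases (norm_nonneg (z - ζ)).eq_or_lt with h0 | h0
    · rw [← h0]; simp
    · rw [mul_div_assoc', le_div_iff₀ (by positivity)]
      rw [inv_mul_cancel_left₀ h0.ne']
      nlinarith

/-- The **Cauchy-Pompeiu formula** for the average of a function over discs of radius `δ`. -/
lemma integral_circleIntegral_mul_inv_sub {f : ℂ → ℂ} (hf : Continuous f)
    (hfc : HasCompactSupport f) {δ : ℝ} (hδ : 0 < δ) (z : ℂ) :
    ∫ ζ, (∮ w in C(ζ, δ), f w) * (z - ζ)⁻¹ = 2 * Real.pi * Complex.I * ∫ w in ball z δ, f w := by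
  set μ : Measure ℝ := volume.restrict (Set.Ioc 0 (2 * Real.pi)) with hμ
  obtain ⟨M, hM⟩ := hf.bounded_above_of_compact_support hfc
  obtain ⟨R, hR⟩ : ∃ R : ℝ, ∀ w, f w ≠ 0 → ‖w‖ ≤ R := by
    obtain ⟨R, hR⟩ := hfc.isBounded.exists_norm_le
    exact ⟨R, fun w hw => hR w (subset_tsupport f hw)⟩
  have hM0 : 0 ≤ M := (norm_nonneg _).trans (hM 0)
  let c : ℝ → ℂ := fun θ => circleMap 0 δ θ * Complex.I
  have hc : ∀ θ, ‖c θ‖ = δ := fun θ => by simp [c, abs_of_pos hδ]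
  have hcc : Continuous c := by fun_prop
  let F : ℝ × ℂ → ℂ := fun p => c p.1 * f (circleMap p.2 δ p.1) * (z - p.2)⁻¹
  have hcm : ∀ (ζ : ℂ) (θ : ℝ), circleMap ζ δ θ = ζ + circleMap 0 δ θ := fun ζ θ => by
    simp [circleMap]
  have hcmc : Continuous fun p : ℝ × ℂ => circleMap p.2 δ p.1 := by
    unfold circleMap; fun_prop
  have hFm : Measurable F :=
    (((hcc.comp continuous_fst).mul (hf.comp hcmc)).measurable).mul
      ((measurable_const.sub measurable_snd).inv)
  have hFi : Integrable F (μ.prod volume) := by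
    have hb : Integrable (fun ζ : ℂ => (closedBall (0 : ℂ) (R + δ)).indicator
        (fun ζ => ‖z - ζ‖⁻¹) ζ) :=
      (integrable_indicator_iff measurableSet_closedBall).2 (integrableOn_inv_norm_sub z (R + δ))
    have hb2 : Integrable (fun p : ℝ × ℂ => (δ * M) * (closedBall (0 : ℂ) (R + δ)).indicator
        (fun ζ => ‖z - ζ‖⁻¹) p.2) (μ.prod volume) :=
      ((integrable_const (δ * M)).mul_prod hb)
    refine hb2.mono' hFm.aestronglyMeasurable (Eventually.of_forall fun p => ?_)
    by_cases h0 : f (circleMap p.2 δ p.1) = 0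
    · simp only [F, h0, mul_zero, zero_mul, norm_zero]
      exact mul_nonneg (by positivity) (Set.indicator_nonneg (fun _ _ => by positivity) _)
    · have h1 : p.2 ∈ closedBall (0 : ℂ) (R + δ) := by
        rw [mem_closedBall_zero_iff]
        have h2 := hR _ h0
        have h3 : p.2 = circleMap p.2 δ p.1 - circleMap 0 δ p.1 := by rw [hcm p.2]; ring
        rw [h3]
        refine (norm_sub_le _ _).trans (add_le_add h2 ?_)
        simp [abs_of_pos hδ]
      rw [Set.indicator_of_mem h1]
      simp only [F, norm_mul, hc, norm_inv]
      gcongr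
      exact hM _
  let G : ℝ × ℂ → ℂ := fun p => c p.1 * f p.2 * (z - p.2 + circleMap 0 δ p.1)⁻¹
  have hGF : G = F ∘ fun p : ℝ × ℂ => (p.1, p.2 - circleMap 0 δ p.1) := by
    funext p
    simp only [G, F, Function.comp, hcm (p.2 - circleMap 0 δ p.1)]
    congr 2
    · ring_nf
    · ring
  have hGi : Integrable G (μ.prod volume) := by
    rw [hGF]
    have hmp : MeasurePreserving (fun p : ℝ × ℂ => (p.1, p.2 - circleMap 0 δ p.1))
        (μ.prod volume) (μ.prod volume) := by
      refine (MeasurePreserving.id μ).skew_product (g := fun θ w => w - circleMap 0 δ θ) ?_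
        (Eventually.of_forall fun θ => (measurePreserving_sub_right volume _).map_eq)
      exact (by fun_prop : Continuous fun p : ℝ × ℂ => p.2 - circleMap 0 δ p.1).measurable
    exact hmp.integrable_comp_of_integrable hFi
  have hci : ∀ (g : ℂ → ℂ) (ζ : ℂ), (∮ w in C(ζ, δ), g w) = ∫ θ, c θ * g (circleMap ζ δ θ) ∂μ := by
    intro g ζ
    rw [circleIntegral, intervalIntegral.integral_of_le (by positivity)]
    simp [c, deriv_circleMap, hμ]
  have hinner : ∀ w : ℂ, dist w z ≠ δ → ∫ θ, G (θ, w) ∂μ =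
      (ball z δ).indicator (fun w => 2 * Real.pi * Complex.I * f w) w := by
    intro w hw
    have h1 : ∫ θ, G (θ, w) ∂μ = f w * ∮ v in C(0, δ), (v - (w - z))⁻¹ := by
      rw [hci, ← integral_const_mul]
      congr 1
      funext θ
      simp only [G]
      rw [show z - w + circleMap 0 δ θ = circleMap 0 δ θ - (w - z) by ring]
      ring
    rw [h1]
    by_cases hwb : w ∈ ball z δ
    · rw [Set.indicator_of_mem hwb, circleIntegral.integral_sub_inv_of_mem_ball
        (by simpa [dist_eq_norm] using hwb)]
      ring
    · rw [Set.indicator_of_notMem hwb]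
      have hlt : δ < ‖w - z‖ := by
        rw [← dist_eq_norm]
        exact lt_of_le_of_ne (not_lt.1 hwb) hw.symm
      have hne : ∀ v ∈ closedBall (0 : ℂ) δ, v - (w - z) ≠ 0 := fun v hv h => by
        rw [sub_eq_zero.1 h, mem_closedBall_zero_iff] at hv
        linarith
      rw [Complex.circleIntegral_eq_zero_of_differentiable_on_off_countable hδ.le
        Set.countable_empty, mul_zero]
      · exact ContinuousOn.inv₀ (by fun_prop) hne
      · intro v hv
        exact DifferentiableAt.inv (by fun_prop) (hne v (ball_subset_closedBall hv.1))
  calc ∫ ζ, (∮ w in C(ζ, δ), f w) * (z - ζ)⁻¹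
      = ∫ ζ, ∫ θ, F (θ, ζ) ∂μ := by
        congr 1
        funext ζ
        rw [hci, ← integral_mul_const]
    _ = ∫ θ, (∫ ζ : ℂ, F (θ, ζ)) ∂μ := (integral_integral_swap (f := fun θ ζ => F (θ, ζ)) hFi).symm
    _ = ∫ θ, (∫ w : ℂ, G (θ, w)) ∂μ := by
        congr 1
        funext θ
        rw [hGF]
        exact (integral_sub_right_eq_self (fun w => F (θ, w)) (circleMap 0 δ θ)).symm
    _ = ∫ w, ∫ θ, G (θ, w) ∂μ := integral_integral_swap (f := fun θ w => G (θ, w)) hGi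
    _ = ∫ w, (ball z δ).indicator (fun w => 2 * Real.pi * Complex.I * f w) w := by
        refine integral_congr_ae ?_
        have hs : volume (sphere z δ) = 0 := Measure.addHaar_sphere _ _ _
        filter_upwards [compl_mem_ae_iff.2 hs] with w hw
        exact hinner w hw
    _ = _ := by rw [integral_indicator measurableSet_ball, integral_const_mul]

end CauchyTransform

section Mergelyan

open MeasureTheory

lemma integrableOn_mul_inv_sub {D : ℂ → ℂ} (hD : Measurable D) {M : ℝ} (hM : ∀ ζ, ‖D ζ‖ ≤ M)
    {X : Set ℂ} (hX : Bornology.IsBounded X) (z : ℂ) :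
    IntegrableOn (fun ζ => D ζ * (z - ζ)⁻¹) X := by
  obtain ⟨R, hR⟩ := hX.subset_closedBall 0
  have h1 := ((integrableOn_inv_norm_sub z R).mono_set hR).const_mul M
  refine h1.mono' (by fun_prop) (Eventually.of_forall fun ζ => ?_)
  rw [norm_mul, norm_inv]
  exact mul_le_mul_of_nonneg_right (hM ζ) (by positivity)

lemma norm_setIntegral_sub_le_of_kernel {D : ℂ → ℂ} (hD : Measurable D) {M : ℝ}
    (hM : ∀ ζ, ‖D ζ‖ ≤ M) {Y : Set ℂ} (hY : MeasurableSet Y) (hYb : Bornology.IsBounded Y)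
    {r C : ℝ} (hr : 0 < r) (z g m : ℂ)
    (hg : ∀ ζ ∈ Y, z ≠ ζ → ‖g + (ζ - m) * g ^ 2 - (z - ζ)⁻¹‖ ≤ C * errorKernel r (z - ζ)) :
    ‖(∫ ζ in Y, D ζ) * g + (∫ ζ in Y, D ζ * (ζ - m)) * g ^ 2 - ∫ ζ in Y, D ζ * (z - ζ)⁻¹‖ ≤
      M * C * ∫ ζ in Y, errorKernel r (z - ζ) := by
  have hM0 : 0 ≤ M := (norm_nonneg _).trans (hM 0)
  obtain ⟨R, hR⟩ := hYb.subset_closedBall 0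
  have hfin : volume Y < ⊤ := hYb.measure_lt_top
  have h1 : IntegrableOn D Y :=
    IntegrableOn.of_bound hfin hD.aestronglyMeasurable M (Eventually.of_forall hM)
  have h2 : IntegrableOn (fun ζ => D ζ * (ζ - m)) Y := by
    refine IntegrableOn.of_bound hfin (by fun_prop) (M * (R + ‖m‖)) ?_
    refine (ae_restrict_iff' hY).2 (Eventually.of_forall fun ζ hζ => ?_)
    rw [norm_mul]
    refine mul_le_mul (hM ζ) ((norm_sub_le _ _).trans ?_) (norm_nonneg _) hM0
    gcongr
    exact mem_closedBall_zero_iff.1 (hR hζ)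
  have h3 := integrableOn_mul_inv_sub hD hM hYb z
  have h4 : Integrable (fun ζ => D ζ * g + D ζ * (ζ - m) * g ^ 2) (volume.restrict Y) :=
    Integrable.add (h1.mul_const g) (h2.mul_const (g ^ 2))
  rw [← integral_mul_const, ← integral_mul_const,
    ← integral_add (h1.mul_const _) (h2.mul_const _),
    ← integral_sub h4 h3, ← integral_const_mul]
  refine norm_integral_le_of_norm_le
    ((((integrable_errorKernel hr).comp_sub_left z).integrableOn).const_mul _) ?_
  have hne : ∀ᵐ ζ ∂(volume.restrict Y), ζ ≠ z := Measure.ae_ne _ z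
  filter_upwards [(ae_restrict_iff' hY).2 (Eventually.of_forall fun ζ hζ => hζ), hne] with ζ hζ hz
  have : D ζ * g + D ζ * (ζ - m) * g ^ 2 - D ζ * (z - ζ)⁻¹
      = D ζ * (g + (ζ - m) * g ^ 2 - (z - ζ)⁻¹) := by ring
  rw [this, norm_mul, mul_assoc]
  exact mul_le_mul (hM ζ) (hg ζ hζ hz.symm) (norm_nonneg _) hM0

lemma exists_mem_polyClosure_norm_sub_setIntegral_le {K : Set ℂ} [CompactSpace K]
    (hK : IsPreconnected Kᶜ) {r : ℝ} (hr : 0 < r) {D : ℂ → ℂ} (hD : Measurable D) {M : ℝ}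
    (hM : ∀ ζ, ‖D ζ‖ ≤ M) (t : Finset ℂ) (ht : ∀ c ∈ t, c ∉ K) (X : Set ℂ)
    (hX : MeasurableSet X) (hXb : Bornology.IsBounded X) (hXt : X ⊆ ⋃ c ∈ t, ball c r) :
    ∃ F ∈ polyClosure K, ∀ z : K, ‖F z - ∫ ζ in X, D ζ * ((z : ℂ) - ζ)⁻¹‖ ≤
      M * 10 ^ 8 * ∫ ζ in X, errorKernel r (z - ζ) := by
  induction t using Finset.induction_on generalizing X with
  | empty =>
    have : X = ∅ := by simpa using hXt
    subst this
    exact ⟨0, zero_mem _, fun z => by simp⟩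
  | insert c t hc ih =>
    obtain ⟨F, hF, hFX⟩ := ih (fun a ha => ht a (Finset.mem_insert_of_mem ha)) (X \ ball c r)
      (hX.diff measurableSet_ball) (hXb.subset Set.sdiff_subset) (by
        intro x hx
        have := hXt hx.1
        simp only [Finset.mem_insert, Set.iUnion_iUnion_eq_or_left, Set.mem_union] at this
        exact this.resolve_left hx.2)
    obtain ⟨m, g, hg, hgX⟩ := exists_cauchy_kernel_approx hK (ht c (Finset.mem_insert_self _ _)) hr
    set Y := X ∩ ball c r with hY
    refine ⟨F + ((∫ ζ in Y, D ζ) • g + (∫ ζ in Y, D ζ * (ζ - m)) • g ^ 2),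
      add_mem hF (add_mem (Subalgebra.smul_mem _ hg _)
        (Subalgebra.smul_mem _ (pow_mem hg 2) _)), fun z => ?_⟩
    have hYb : Bornology.IsBounded Y := hXb.subset Set.inter_subset_left
    have h1 := norm_setIntegral_sub_le_of_kernel hD hM (hX.inter measurableSet_ball)
      hYb hr (z : ℂ) (g z) m (fun ζ hζ hne => hgX z ζ hζ.2 hne)
    have h2 := hFX z
    rw [← integral_inter_add_sdiff measurableSet_ball (t := ball c r)
        (integrableOn_mul_inv_sub hD hM hXb z),
      ← integral_inter_add_sdiff measurableSet_ball (t := ball c r)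
        (((integrable_errorKernel hr).comp_sub_left (z : ℂ)).integrableOn), mul_add]
    refine le_trans (le_of_eq ?_) ((norm_add_le _ _).trans (add_le_add h1 h2))
    congr 1
    simp only [ContinuousMap.add_apply, ContinuousMap.smul_apply, ContinuousMap.pow_apply,
      smul_eq_mul]
    ring

lemma continuous_circleIntegral_center {f : ℂ → ℂ} (hf : Continuous f) (δ : ℝ) :
    Continuous fun ζ => ∮ w in C(ζ, δ), f w := by
  unfold circleIntegral
  apply intervalIntegral.continuous_parametric_intervalIntegral_of_continuous'
  simp only [deriv_circleMap, circleMap]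
  fun_prop

lemma norm_circleIntegral_le_of_norm_sub_le {f : ℂ → ℂ} (hf : Continuous f) {δ ω : ℝ}
    (hδ : 0 < δ) {ζ : ℂ} (h : ∀ w ∈ sphere ζ δ, ‖f w - f ζ‖ ≤ ω) :
    ‖∮ w in C(ζ, δ), f w‖ ≤ 2 * Real.pi * δ * ω := by
  have h0 : (∮ _ in C(ζ, δ), f ζ) = 0 :=
    Complex.circleIntegral_eq_zero_of_differentiable_on_off_countable hδ.le Set.countable_empty
      continuousOn_const fun z _ => differentiableAt_const _
  have h1 := circleIntegral.norm_integral_le_of_norm_le_const hδ.le h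
  rwa [circleIntegral.integral_sub hf.continuousOn.circleIntegrable'
    continuousOn_const.circleIntegrable', h0, sub_zero] at h1

lemma norm_setIntegral_ball_sub_le {f : ℂ → ℂ} (hf : Continuous f) {δ ω : ℝ} (hδ : 0 < δ) {z : ℂ}
    (h : ∀ w ∈ ball z δ, ‖f w - f z‖ ≤ ω) :
    ‖(Real.pi * δ ^ 2 : ℂ)⁻¹ * (∫ w in ball z δ, f w) - f z‖ ≤ ω := by
  have hv : volume.real (ball z δ) = Real.pi * δ ^ 2 := by
    simp [Measure.real, Complex.volume_ball, hδ.le, mul_comm]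
  have hv0 : (Real.pi * δ ^ 2 : ℂ) ≠ 0 := by
    have := Real.pi_pos
    exact_mod_cast (by positivity : Real.pi * δ ^ 2 ≠ 0)
  have h1 : ‖∫ w in ball z δ, (f w - f z)‖ ≤ ω * volume.real (ball z δ) :=
    norm_setIntegral_le_of_norm_le_const measure_ball_lt_top h
  have h2 : IntegrableOn f (ball z δ) :=
    (hf.continuousOn.integrableOn_compact (isCompact_closedBall z δ)).mono_set ball_subset_closedBall
  rw [integral_sub h2 (integrableOn_const measure_ball_lt_top.ne), setIntegral_const, hv] at h1
  have h3 : (Real.pi * δ ^ 2 : ℂ)⁻¹ * (∫ w in ball z δ, f w) - f z =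
      (Real.pi * δ ^ 2 : ℂ)⁻¹ * ((∫ w in ball z δ, f w) - (Real.pi * δ ^ 2 : ℝ) • f z) := by
    rw [Complex.real_smul]
    push_cast
    rw [mul_sub, inv_mul_cancel_left₀ hv0]
  have h4 : ‖(Real.pi * δ ^ 2 : ℂ)‖ = Real.pi * δ ^ 2 := by
    simp [abs_of_pos Real.pi_pos]
  have := Real.pi_pos
  rw [h3, norm_mul, norm_inv, h4, inv_mul_le_iff₀ (by positivity)]
  linarith

lemma exists_dist_lt_of_circleIntegral_ne_zero {K : Set ℂ} {f : ℂ → ℂ} (hf : Continuous f)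
    (hfd : DifferentiableOn ℂ f (interior K)) {δ : ℝ} (hδ : 0 < δ) {ζ : ℂ}
    (h : (∮ w in C(ζ, δ), f w) ≠ 0) : ∃ c ∉ K, dist c ζ < 2 * δ := by
  have h1 : ¬ closedBall ζ δ ⊆ interior K := fun hs => h <|
    Complex.circleIntegral_eq_zero_of_differentiable_on_off_countable hδ.le Set.countable_empty
      hf.continuousOn fun z hz =>
        (hfd z (hs (ball_subset_closedBall hz.1))).differentiableAt
          (isOpen_interior.mem_nhds (hs (ball_subset_closedBall hz.1)))
  obtain ⟨w, hw, hwK⟩ := Set.not_subset.1 h1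
  rw [← Set.mem_compl_iff, ← closure_compl] at hwK
  obtain ⟨c, hc, hcw⟩ := Metric.mem_closure_iff.1 hwK δ hδ
  refine ⟨c, hc, ?_⟩
  have := dist_triangle c w ζ
  rw [dist_comm] at hcw
  rw [mem_closedBall] at hw
  linarith

/-- **Mergelyan's theorem** for functions extending to compactly supported ones. -/
lemma exists_polynomial_of_hasCompactSupport {K : Set ℂ} [CompactSpace K] (hK : IsPreconnected Kᶜ)
    {f : ℂ → ℂ} (hf : Continuous f) (hfc : HasCompactSupport f)
    (hfd : DifferentiableOn ℂ f (interior K)) {ε : ℝ} (hε : 0 < ε) :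
    ∃ p : ℂ[X], ∀ z ∈ K, ‖p.eval z - f z‖ < ε := by
  set ω := ε / (2 * 10 ^ 9) with hωdef
  have hω : 0 < ω := by positivity
  have hpi := Real.pi_pos
  obtain ⟨δ₀, hδ₀, hfδ⟩ := Metric.uniformContinuous_iff.1
    (hfc.uniformContinuous_of_continuous hf) ω hω
  obtain ⟨δ, hδ, hδδ⟩ := exists_between hδ₀
  have hosc : ∀ w ζ, dist w ζ ≤ δ → ‖f w - f ζ‖ ≤ ω := fun w ζ h => by
    rw [← dist_eq_norm]
    exact (hfδ (h.trans_lt hδδ)).le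
  set D : ℂ → ℂ := fun ζ => ∮ w in C(ζ, δ), f w with hD
  have hDc : Continuous D := continuous_circleIntegral_center hf δ
  have hDb : ∀ ζ, ‖D ζ‖ ≤ 2 * Real.pi * δ * ω := fun ζ =>
    norm_circleIntegral_le_of_norm_sub_le hf hδ fun w hw => hosc w ζ (mem_sphere.1 hw).le
  obtain ⟨R, hR⟩ : ∃ R : ℝ, ∀ w, f w ≠ 0 → ‖w‖ ≤ R := by
    obtain ⟨R, hR⟩ := hfc.isBounded.exists_norm_le
    exact ⟨R, fun w hw => hR w (subset_tsupport f hw)⟩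
  set X := Function.support D with hX
  have hXb : X ⊆ closedBall 0 (R + δ) := by
    intro ζ hζ
    by_contra hcon
    refine hζ ?_
    have h0 : ∀ w ∈ sphere ζ δ, ‖f w‖ ≤ 0 := by
      intro w hw
      rw [norm_le_zero_iff]
      by_contra hw0
      refine hcon ?_
      have h1 := hR w hw0
      have h2 := norm_sub_norm_le ζ w
      rw [mem_sphere_iff_norm, norm_sub_rev] at hw
      rw [mem_closedBall_zero_iff]
      linarith
    have := circleIntegral.norm_integral_le_of_norm_le_const hδ.le h0
    rw [mul_zero] at this
    exact norm_le_zero_iff.1 this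
  have hXbd : Bornology.IsBounded X := isBounded_closedBall.subset hXb
  obtain ⟨b, hbK, hbfin, hbX⟩ := (hXbd.isCompact_closure).elim_finite_subcover_image
    (b := Kᶜ) (c := fun c => ball c (3 * δ)) (fun _ _ => isOpen_ball) (by
      intro ζ hζ
      obtain ⟨ζ', hζ', hd⟩ := Metric.mem_closure_iff.1 hζ δ hδ
      obtain ⟨c, hc, hcd⟩ := exists_dist_lt_of_circleIntegral_ne_zero hf hfd hδ hζ'
      refine Set.mem_biUnion hc ?_
      rw [mem_ball]
      have := dist_triangle ζ ζ' c
      rw [dist_comm] at hcd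
      linarith)
  obtain ⟨F, hF, hFz⟩ := exists_mem_polyClosure_norm_sub_setIntegral_le hK
    (r := 3 * δ) (by positivity) hDc.measurable hDb hbfin.toFinset
    (fun c hc => hbK (hbfin.mem_toFinset.1 hc)) X hDc.isOpen_support.measurableSet hXbd
    (by simpa using subset_closure.trans hbX)
  have hne : (2 * Real.pi * Complex.I * (Real.pi * δ ^ 2) : ℂ) ≠ 0 := by
    have h1 : (Real.pi : ℂ) ≠ 0 := by exact_mod_cast hpi.ne'
    have h2 : (δ : ℂ) ≠ 0 := by exact_mod_cast hδ.ne'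
    simp [h1, h2]
  have hG : (2 * Real.pi * Complex.I * (Real.pi * δ ^ 2) : ℂ)⁻¹ • F ∈ polyClosure K :=
    Subalgebra.smul_mem _ hF _
  obtain ⟨p, hp⟩ := exists_polynomial_of_mem_polyClosure hG (half_pos hε)
  refine ⟨p, fun z hz => ?_⟩
  have h1 := hp ⟨z, hz⟩
  have h2 := hFz ⟨z, hz⟩
  have h3 := norm_setIntegral_ball_sub_le hf hδ (z := z) (ω := ω)
    (fun w hw => hosc w z (mem_ball.1 hw).le)
  rw [setIntegral_eq_integral_of_forall_compl_eq_zero (by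
    intro ζ hζ
    rw [Function.notMem_support.1 hζ, zero_mul])] at h2
  simp only [hD] at h2
  rw [integral_circleIntegral_mul_inv_sub hf hfc hδ] at h2
  have h4 : ∫ ζ in X, errorKernel (3 * δ) (z - ζ) ≤ Real.pi ^ 2 * (3 * δ) := by
    rw [← integral_errorKernel (r := 3 * δ) (by positivity),
      ← integral_sub_left_eq_self (errorKernel (3 * δ)) volume z]
    exact setIntegral_le_integral ((integrable_errorKernel (by positivity)).comp_sub_left z)
      (Eventually.of_forall fun ζ => errorKernel_nonneg _ _)
  have h5 : ‖(2 * Real.pi * Complex.I * (Real.pi * δ ^ 2) : ℂ)⁻¹ * F ⟨z, hz⟩ -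
      (Real.pi * δ ^ 2 : ℂ)⁻¹ * ∫ w in ball z δ, f w‖ ≤ 3 * Real.pi * 10 ^ 8 * ω := by
    have e : (2 * Real.pi * Complex.I * (Real.pi * δ ^ 2) : ℂ)⁻¹ * F ⟨z, hz⟩ -
      (Real.pi * δ ^ 2 : ℂ)⁻¹ * ∫ w in ball z δ, f w =
      (2 * Real.pi * Complex.I * (Real.pi * δ ^ 2) : ℂ)⁻¹ *
        (F ⟨z, hz⟩ - 2 * Real.pi * Complex.I * ∫ w in ball z δ, f w) := by
      have h1 : (Real.pi : ℂ) ≠ 0 := by exact_mod_cast hpi.ne'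
      have h2 : (δ : ℂ) ≠ 0 := by exact_mod_cast hδ.ne'
      field_simp
    have e' : ‖(2 * Real.pi * Complex.I * (Real.pi * δ ^ 2) : ℂ)‖ =
        2 * Real.pi * (Real.pi * δ ^ 2) := by
      simp [abs_of_pos hpi]
    rw [e, norm_mul, norm_inv, e', inv_mul_le_iff₀ (by positivity)]
    refine h2.trans ((mul_le_mul_of_nonneg_left h4 (by positivity)).trans (le_of_eq ?_))
    ring
  have h6 := norm_add_le (p.eval z - ((2 * Real.pi * Complex.I * (Real.pi * δ ^ 2) : ℂ)⁻¹ • F) ⟨z, hz⟩)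
    (((2 * Real.pi * Complex.I * (Real.pi * δ ^ 2) : ℂ)⁻¹ * F ⟨z, hz⟩ -
      (Real.pi * δ ^ 2 : ℂ)⁻¹ * ∫ w in ball z δ, f w) +
      ((Real.pi * δ ^ 2 : ℂ)⁻¹ * (∫ w in ball z δ, f w) - f z))
  have h7 := norm_add_le ((2 * Real.pi * Complex.I * (Real.pi * δ ^ 2) : ℂ)⁻¹ * F ⟨z, hz⟩ -
      (Real.pi * δ ^ 2 : ℂ)⁻¹ * ∫ w in ball z δ, f w)
      ((Real.pi * δ ^ 2 : ℂ)⁻¹ * (∫ w in ball z δ, f w) - f z)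
  have h8 : 3 * Real.pi * 10 ^ 8 * ω ≤ 96 / 10 * 10 ^ 8 * ω := by
    have := Real.pi_lt_d2
    gcongr
    linarith
  have h9 : ω * (2 * 10 ^ 9) = ε := by rw [hωdef]; field_simp
  have e1 : p.eval z - f z =
    (p.eval z - ((2 * Real.pi * Complex.I * (Real.pi * δ ^ 2) : ℂ)⁻¹ • F) ⟨z, hz⟩) +
    (((2 * Real.pi * Complex.I * (Real.pi * δ ^ 2) : ℂ)⁻¹ * F ⟨z, hz⟩ -
      (Real.pi * δ ^ 2 : ℂ)⁻¹ * ∫ w in ball z δ, f w) +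
      ((Real.pi * δ ^ 2 : ℂ)⁻¹ * (∫ w in ball z δ, f w) - f z)) := by
    rw [ContinuousMap.smul_apply, smul_eq_mul]
    ring
  rw [e1]
  linarith

/-- **Mergelyan's theorem**. -/
theorem exists_polynomial_norm_sub_lt {K : Set ℂ} (hKc : IsCompact K) (hK : IsPreconnected Kᶜ)
    {h : ℂ → ℂ} (hc : ContinuousOn h K) (hd : DifferentiableOn ℂ h (interior K)) {ε : ℝ}
    (hε : 0 < ε) : ∃ p : ℂ[X], ∀ z ∈ K, ‖p.eval z - h z‖ < ε := by
  have : CompactSpace K := isCompact_iff_compactSpace.1 hKc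
  obtain ⟨g, hg⟩ := ContinuousMap.exists_restrict_eq hKc.isClosed
    (⟨K.domRestrict h, hc.domRestrict⟩ : C(K, ℂ))
  obtain ⟨χ, hχ1, -, hχc, -⟩ := exists_continuous_one_zero_of_isCompact hKc isClosed_empty
    (Set.disjoint_empty K)
  have hfK : Set.EqOn (fun z => (χ z : ℂ) * g z) h K := by
    intro z hz
    have h1 : g z = h z := DFunLike.congr_fun hg ⟨z, hz⟩
    simp [hχ1 hz, h1]
  obtain ⟨p, hp⟩ := exists_polynomial_of_hasCompactSupport hK (f := fun z => (χ z : ℂ) * g z)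
    (by fun_prop)
    (by
      refine HasCompactSupport.mul_right ?_
      exact hχc.comp_left Complex.ofReal_zero)
    (hd.congr fun z hz => hfK (interior_subset hz)) hε
  exact ⟨p, fun z hz => by simpa [hfK hz] using hp z hz⟩

end Mergelyan

lemma isPreconnected_norm_mem {I : Set ℝ} (hI : I.OrdConnected) :
    IsPreconnected {z : ℂ | ‖z‖ ∈ I} := by
  have h1 : IsPreconnected ((I ∩ Set.Ici 0) ×ˢ (Set.univ : Set ℝ)) :=
    (hI.inter Set.ordConnected_Ici).isPreconnected.prod isPreconnected_univ
  have h2 : Continuous fun p : ℝ × ℝ => circleMap 0 p.1 p.2 := by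
    simp only [circleMap]
    fun_prop
  convert h1.image _ h2.continuousOn using 1
  ext z
  constructor
  · intro hz
    exact ⟨(‖z‖, z.arg), ⟨⟨hz, norm_nonneg z⟩, trivial⟩, by
      simp [circleMap, Complex.norm_mul_exp_arg_mul_I]⟩
  · rintro ⟨p, ⟨⟨hp, hp0⟩, -⟩, rfl⟩
    simpa [abs_of_nonneg (Set.mem_Ici.1 hp0)] using hp

lemma IsPreconnected.diff_closedBall {V : Set ℂ} (hVo : IsOpen V) (hV : IsPreconnected V)
    {r : ℝ} (hr : r < 1) (hb : ball (0 : ℂ) 1 ⊆ V) : IsPreconnected (V \ closedBall 0 r) := by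
  have hA : IsPreconnected (ball (0 : ℂ) 1 \ closedBall 0 r) := by
    convert isPreconnected_norm_mem (Set.ordConnected_Ioo (a := r) (b := 1)) using 1
    ext z
    simp [and_comm]
  have hUo : IsOpen (V \ closedBall 0 r) := hVo.sdiff isClosed_closedBall
  have key : ∀ u v : Set ℂ, IsOpen u → IsOpen v → V \ closedBall 0 r ⊆ u ∪ v →
      (V \ closedBall 0 r) ∩ (u ∩ v) = ∅ → ball (0 : ℂ) 1 \ closedBall 0 r ⊆ u →
      V \ closedBall 0 r ⊆ u := by
    intro u v hu hv hUuv hdis hAu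
    have h1 : V ⊆ ((V \ closedBall 0 r) ∩ u ∪ ball 0 1) ∪ ((V \ closedBall 0 r) ∩ v) := by
      intro z hz
      by_cases hzr : z ∈ closedBall (0 : ℂ) r
      · exact Or.inl (Or.inr (closedBall_subset_ball hr hzr))
      · exact (hUuv ⟨hz, hzr⟩).imp (fun h => Or.inl ⟨⟨hz, hzr⟩, h⟩) fun h => ⟨⟨hz, hzr⟩, h⟩
    have h2 : V ∩ (((V \ closedBall 0 r) ∩ u ∪ ball 0 1) ∩ ((V \ closedBall 0 r) ∩ v)) = ∅ := by
      rw [Set.eq_empty_iff_forall_notMem]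
      rintro z ⟨-, h1 | h1, h2⟩
      · exact Set.eq_empty_iff_forall_notMem.1 hdis z ⟨h1.1, h1.2, h2.2⟩
      · exact Set.eq_empty_iff_forall_notMem.1 hdis z ⟨h2.1, hAu ⟨h1, h2.1.2⟩, h2.2⟩
    intro z hz
    rcases isPreconnected_iff_subset_of_disjoint.1 hV _ _ ((hUo.inter hu).union isOpen_ball)
      (hUo.inter hv) h1 h2 with h | h
    · exact (h hz.1).elim (fun h => h.2) fun h => hAu ⟨h, hz.2⟩
    · have h0 := h (hb (mem_ball_self one_pos))
      exact (Set.eq_empty_iff_forall_notMem.1 hdis 0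
        ⟨h0.1, hAu ⟨mem_ball_self one_pos, h0.1.2⟩, h0.2⟩).elim
  rw [isPreconnected_iff_subset_of_disjoint]
  intro u v hu hv hUuv hdis
  have hAU : ball (0 : ℂ) 1 \ closedBall 0 r ⊆ V \ closedBall 0 r := Set.sdiff_subset_sdiff_left hb
  rcases isPreconnected_iff_subset_of_disjoint.1 hA u v hu hv (hAU.trans hUuv)
    (Set.eq_empty_of_subset_empty ((Set.inter_subset_inter_left _ hAU).trans hdis.subset)) with h | h
  · exact Or.inl (key u v hu hv hUuv hdis h)
  · exact Or.inr (key v u hv hu (by rwa [Set.union_comm]) (by rwa [Set.inter_comm v u]) h)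

/-- Compact sets off the closed unit disc's interior and the point `1`, with connected
complement. -/
def IsAdmissible (K : Set ℂ) : Prop :=
  IsCompact K ∧ Disjoint K (unitD ∪ {1}) ∧ IsPreconnected Kᶜ

lemma IsAdmissible.isPreconnected_compl_union {K : Set ℂ} (hK : IsAdmissible K) {r : ℝ}
    (hr : r < 1) : IsPreconnected (K ∪ closedBall 0 r)ᶜ := by
  rw [Set.compl_union, ← Set.sdiff_eq]
  exact hK.2.2.diff_closedBall hK.1.isClosed.isOpen_compl hr
    (Set.subset_compl_iff_disjoint_left.2 (hK.2.1.mono_right Set.subset_union_left))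

/-- A countable family of open balls forming a basis of the topology of `ℂ`. -/
def denseBall (i : ℕ × ℕ) : Set ℂ := ball (TopologicalSpace.denseSeq ℂ i.1) (1 / (i.2 + 1))

lemma exists_denseBall {U : Set ℂ} (hU : IsOpen U) {x : ℂ} (hx : x ∈ U) :
    ∃ i, x ∈ denseBall i ∧ denseBall i ⊆ U := by
  obtain ⟨ε, hε, hεU⟩ := Metric.isOpen_iff.1 hU x hx
  obtain ⟨k, hk⟩ := exists_nat_one_div_lt (half_pos hε)
  obtain ⟨i, hi⟩ := (TopologicalSpace.denseRange_denseSeq ℂ).exists_dist_lt x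
    (Nat.one_div_pos_of_nat (n := k) (α := ℝ))
  refine ⟨(i, k), hi, fun y hy => hεU ?_⟩
  have hy' : dist y (TopologicalSpace.denseSeq ℂ i) < 1 / (k + 1) := hy
  have := dist_triangle_right y x (TopologicalSpace.denseSeq ℂ i)
  rw [mem_ball]
  linarith

/-- The compact set cut out of a disc by removing the unit disc and finitely many balls. -/
def cutDisc (R : ℕ) (s : Finset (ℕ × ℕ)) : Set ℂ :=
  closedBall 0 R \ (ball 0 1 ∪ ⋃ i ∈ s, denseBall i)

lemma isOpen_biUnion_denseBall (s : Finset (ℕ × ℕ)) : IsOpen (⋃ i ∈ s, denseBall i) :=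
  isOpen_biUnion fun _ _ => isOpen_ball

lemma isAdmissible_cutDisc {R : ℕ} {s : Finset (ℕ × ℕ)} (h1 : (1 : ℂ) ∈ ⋃ i ∈ s, denseBall i)
    (hs : IsPreconnected (⋃ i ∈ s, denseBall i)) {w : ℂ} (hw : w ∈ ⋃ i ∈ s, denseBall i)
    (hwR : R < ‖w‖) : IsAdmissible (cutDisc R s) := by
  refine ⟨(isCompact_closedBall _ _).diff (isOpen_ball.union (isOpen_biUnion_denseBall s)), ?_, ?_⟩
  · refine Set.disjoint_left.2 fun z hz h => hz.2 ?_
    rcases h with h | h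
    · exact Or.inl h
    · exact Or.inr (Set.mem_singleton_iff.1 h ▸ h1)
  · have e : (cutDisc R s)ᶜ = (⋃ i ∈ s, denseBall i) ∪ ball 0 1 ∪ {z : ℂ | ‖z‖ ∈ Set.Ioi (R : ℝ)} := by
      ext z
      simp only [cutDisc, Set.mem_compl_iff, Set.mem_sdiff, mem_closedBall_zero_iff,
        Set.mem_union, Set.mem_ofPred_eq, Set.mem_Ioi, ← not_le]
      tauto
    rw [e]
    refine (IsPreconnected.union' ?_ (hs.union' ?_ (convex_ball _ _).isPreconnected)
      (isPreconnected_norm_mem Set.ordConnected_Ioi))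
    · exact ⟨w, Or.inl hw, hwR⟩
    · have : (1 : ℂ) ∈ closure (ball (0 : ℂ) 1) := by
        rw [closure_ball _ one_ne_zero]
        simp
      obtain ⟨x, hx, hx'⟩ := mem_closure_iff.1 this _ (isOpen_biUnion_denseBall s) h1
      exact ⟨x, hx, hx'⟩

lemma IsAdmissible.exists_subset_cutDisc {K : Set ℂ} (hK : IsAdmissible K) :
    ∃ R s, IsAdmissible (cutDisc R s) ∧ K ⊆ cutDisc R s := by
  have h1K : (1 : ℂ) ∈ Kᶜ := fun h => Set.disjoint_left.1 hK.2.1 h (Or.inr rfl)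
  obtain ⟨R₀, hR₀⟩ := hK.1.isBounded.exists_norm_le
  obtain ⟨R, hR⟩ := exists_nat_gt R₀
  have hwn : ‖((R + 1 : ℕ) : ℂ)‖ = R + 1 := by
    rw [Complex.norm_natCast]
    push_cast
    rfl
  have hwK : ((R + 1 : ℕ) : ℂ) ∈ Kᶜ := fun h => by
    have := hR₀ _ h
    rw [hwn] at this
    linarith
  have hKo : IsOpen Kᶜ := hK.1.isClosed.isOpen_compl
  have hpc : IsPathConnected Kᶜ := hKo.isConnected_iff_isPathConnected.1 ⟨⟨1, h1K⟩, hK.2.2⟩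
  have hj := hpc.joinedIn _ h1K _ hwK
  set γ := hj.somePath
  set T := Set.range γ with hT
  have hTc : IsCompact T := isCompact_range γ.continuous
  have hTp : IsPreconnected T := isPreconnected_range γ.continuous
  have hTK : T ⊆ Kᶜ := Set.range_subset_iff.2 hj.somePath_mem
  obtain ⟨b, hb, hbf, hTb⟩ := hTc.elim_finite_subcover_image
    (b := {i | (denseBall i ∩ T).Nonempty ∧ denseBall i ⊆ Kᶜ}) (c := denseBall)
    (fun _ _ => isOpen_ball) (fun x hx => by
      obtain ⟨i, hi, hiK⟩ := exists_denseBall hKo (hTK hx)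
      exact Set.mem_biUnion ⟨⟨x, hi, hx⟩, hiK⟩ hi)
  have e : (⋃ i ∈ hbf.toFinset, denseBall i) = ⋃ i ∈ b, denseBall i := by simp
  have hmem1 : (1 : ℂ) ∈ T := ⟨0, γ.source⟩
  have hpre : IsPreconnected (⋃ i ∈ b, denseBall i) := by
    have : (⋃ i ∈ b, denseBall i) = ⋃₀ (insert T ((fun i => denseBall i ∪ T) '' b)) := by
      ext z
      simp only [Set.mem_iUnion, Set.mem_sUnion, Set.mem_insert_iff, Set.mem_image, exists_prop]
      constructor
      · rintro ⟨i, hi, hz⟩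
        exact ⟨_, Or.inr ⟨i, hi, rfl⟩, Or.inl hz⟩
      · rintro ⟨_, rfl | ⟨i, hi, rfl⟩, hz⟩
        · simpa using hTb hz
        · rcases hz with hz | hz
          · exact ⟨i, hi, hz⟩
          · simpa using hTb hz
    rw [this]
    refine isPreconnected_sUnion 1 _ ?_ ?_
    · rintro _ (rfl | ⟨i, -, rfl⟩)
      · exact hmem1
      · exact Or.inr hmem1
    · rintro _ (rfl | ⟨i, hi, rfl⟩)
      · exact hTp
      · exact IsPreconnected.union' (hb hi).1 (convex_ball _ _).isPreconnected hTp
  refine ⟨R, hbf.toFinset, isAdmissible_cutDisc (w := ((R + 1 : ℕ) : ℂ)) (e ▸ hTb hmem1)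
    (e ▸ hpre) (e ▸ hTb ⟨1, γ.target⟩) (by rw [hwn]; linarith), fun z hz => ⟨?_, ?_⟩⟩
  · exact mem_closedBall_zero_iff.2 ((hR₀ z hz).trans hR.le)
  · rintro (h | h)
    · exact Set.disjoint_left.1 hK.2.1 hz (Or.inl h)
    · rw [e] at h
      obtain ⟨i, hi, hzi⟩ := Set.mem_iUnion₂.1 h
      exact (hb hi).2 hzi hz

lemma exists_seq_polynomial_dense {K : Set ℂ} (hK : IsCompact K) :
    ∃ q : ℕ → ℂ[X], ∀ p : ℂ[X], ∀ ε > 0, ∃ n, ∀ z ∈ K, ‖(q n).eval z - p.eval z‖ < ε := by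
  have : CompactSpace K := isCompact_iff_compactSpace.1 hK
  let s : Set C(K, ℂ) := Set.range fun p : ℂ[X] => p.toContinuousMapOn K
  have : Nonempty s := ⟨⟨_, 0, rfl⟩⟩
  choose q hq using fun n => (TopologicalSpace.denseSeq s n).2
  refine ⟨q, fun p ε hε => ?_⟩
  obtain ⟨n, hn⟩ := (TopologicalSpace.denseRange_denseSeq s).exists_dist_lt
    ⟨p.toContinuousMapOn K, p, rfl⟩ hε
  refine ⟨n, fun z hz => ?_⟩
  rw [Subtype.dist_eq, ContinuousMap.dist_lt_iff hε] at hn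
  have := hn ⟨z, hz⟩
  rw [← hq, dist_comm, dist_eq_norm] at this
  simpa using this

/-- A sequence of polynomial targets on admissible sets that approximates every target infinitely
often. -/
lemma exists_seq_targets : ∃ T : ℕ → Set ℂ × ℂ[X], (∀ n, IsAdmissible (T n).1) ∧
    ∀ K, IsAdmissible K → ∀ h : ℂ → ℂ, ContinuousOn h K → DifferentiableOn ℂ h (interior K) →
    ∀ ε > 0, ∀ N, ∃ n ≥ N, K ⊆ (T n).1 ∧ ∀ z ∈ K, ‖(T n).2.eval z - h z‖ < ε := by
  let I := {x : ℕ × Finset (ℕ × ℕ) // IsAdmissible (cutDisc x.1 x.2)}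
  have hne : Nonempty I := by
    have hE : IsAdmissible ∅ := ⟨isCompact_empty, by simp, by
      rw [Set.compl_empty]; exact isPreconnected_univ⟩
    obtain ⟨R, s, h, -⟩ := hE.exists_subset_cutDisc
    exact ⟨⟨(R, s), h⟩⟩
  obtain ⟨e, he⟩ := exists_surjective_nat I
  choose q hq using fun i : I => exists_seq_polynomial_dense i.2.1
  refine ⟨fun n => (cutDisc (e n.unpair.1).1.1 (e n.unpair.1).1.2,
    q (e n.unpair.1) n.unpair.2.unpair.1), fun n => (e n.unpair.1).2, ?_⟩
  intro K hK h hc hd ε hε N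
  obtain ⟨p, hp⟩ := exists_polynomial_norm_sub_lt hK.1 hK.2.2 hc hd (half_pos hε)
  obtain ⟨R, s, hRs, hKs⟩ := hK.exists_subset_cutDisc
  obtain ⟨i, hi⟩ := he ⟨(R, s), hRs⟩
  obtain ⟨n, hn⟩ := hq ⟨(R, s), hRs⟩ p _ (half_pos hε)
  refine ⟨Nat.pair i (Nat.pair n N), (Nat.right_le_pair n N).trans (Nat.right_le_pair i _), ?_⟩
  simp only [Nat.unpair_pair, hi]
  refine ⟨hKs, fun z hz => ?_⟩
  have h1 := hn z (hKs hz)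
  have h2 := hp z hz
  have := norm_sub_le_norm_sub_add_norm_sub ((q ⟨(R, s), hRs⟩ n).eval z) (p.eval z) (h z)
  linarith

section Pade

open Asymptotics

lemma X_pow_dvd_of_isBigO {p : ℂ[X]} {n : ℕ}
    (h : (fun z => p.eval z) =O[𝓝[≠] 0] fun z => z ^ n) : X ^ n ∣ p := by
  induction n generalizing p with
  | zero => simp
  | succ n ih =>
    have h0 : p.eval 0 = 0 := by
      have h1 : Tendsto (fun z : ℂ => z ^ (n + 1)) (𝓝[≠] 0) (𝓝 0) := by
        have : Tendsto (fun z : ℂ => z ^ (n + 1)) (𝓝 0) (𝓝 (0 ^ (n + 1))) :=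
          (continuous_pow (n + 1)).tendsto 0
        simpa using this.mono_left nhdsWithin_le_nhds
      exact tendsto_nhds_unique ((p.continuous.tendsto 0).mono_left nhdsWithin_le_nhds)
        (h.trans_tendsto h1)
    obtain ⟨q, rfl⟩ := X_dvd_iff.2 ((coeff_zero_eq_eval_zero p).trans h0)
    rw [pow_succ']
    refine mul_dvd_mul_left X (ih ?_)
    obtain ⟨C, hC⟩ := h.bound
    refine IsBigO.of_bound C ?_
    filter_upwards [hC, self_mem_nhdsWithin] with z hz hz0
    have hz0' : 0 < ‖z‖ := norm_pos_iff.2 hz0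
    simp only [eval_mul, eval_X, norm_mul, norm_pow, pow_succ'] at hz ⊢
    refine le_of_mul_le_mul_left (hz.trans (le_of_eq ?_)) hz0'
    ring

lemma isBigO_sub_sum_tc {f : ℂ → ℂ} (hf : AnalyticAt ℂ f 0) (n : ℕ) :
    (fun z => f z - (∑ k ∈ range n, C (tc f k) * X ^ k : ℂ[X]).eval z) =O[𝓝 0]
      fun z => z ^ n := by
  have h := hf.hasFPowerSeriesAt.isBigO_sub_partialSum_pow n
  refine (IsBigO.congr_left h fun z => ?_).trans (IsBigO.of_norm_right (by
    simpa using isBigO_refl _ _))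
  simp only [FormalMultilinearSeries.partialSum, FormalMultilinearSeries.ofScalars_apply_eq,
    eval_finsetSum, eval_mul, eval_C, eval_pow, eval_X, tc, smul_eq_mul, zero_add]

lemma sum_coeff_mul_tc_of_isBigO {f : ℂ → ℂ} (hf : AnalyticAt ℂ f 0) {G Q : ℂ[X]} {n : ℕ}
    (h : (fun z => Q.eval z * f z - G.eval z) =O[𝓝 0] fun z => z ^ n) {j : ℕ} (hj : j < n) :
    ∑ i ∈ range (j + 1), Q.coeff i * tc f (j - i) = G.coeff j := by
  set S : ℂ[X] := ∑ k ∈ range n, C (tc f k) * X ^ k with hS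
  have h1 : (fun z => Q.eval z * (f z - S.eval z)) =O[𝓝 0] fun z => z ^ n := by
    have hQ : (fun z => Q.eval z) =O[𝓝 0] fun _ => (1 : ℂ) :=
      (Q.continuous.tendsto 0).isBigO_one ℂ
    simpa using hQ.mul (isBigO_sub_sum_tc hf n)
  have h2 : (fun z => (Q * S - G).eval z) =O[𝓝 0] fun z => z ^ n := by
    refine (h.sub h1).congr_left fun z => ?_
    simp only [eval_sub, eval_mul]
    ring
  have h3 := X_pow_dvd_iff.1 (X_pow_dvd_of_isBigO (h2.mono nhdsWithin_le_nhds)) j hj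
  rw [coeff_sub, sub_eq_zero] at h3
  rw [← h3, coeff_mul, Finset.Nat.sum_antidiagonal_eq_sum_range_succ
    (fun a b => Q.coeff a * S.coeff b)]
  refine Finset.sum_congr rfl fun i _ => ?_
  congr 1
  have : j - i < n := by omega
  simp [hS, finsetSum_coeff, coeff_X_pow, this]

lemma coeff_one_sub_X_zero : (1 - X : ℂ[X]).coeff 0 = 1 := by simp

lemma degree_one_sub_X : (1 - X : ℂ[X]).degree = 1 := by
  rw [← neg_sub, degree_neg, ← C_1, degree_X_sub_C]

lemma sum_one_sub_X_coeff_mul (a : ℕ → ℂ) (j : ℕ) :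
    ∑ i ∈ range (j + 1 + 1), (1 - X : ℂ[X]).coeff i * a (j + 1 - i) = a (j + 1) - a j := by
  rw [Finset.sum_range_succ', Finset.sum_range_succ']
  have : ∀ i ∈ range j, (1 - X : ℂ[X]).coeff (i + 1 + 1) * a (j + 1 - (i + 1 + 1)) = 0 := by
    intro i _
    simp [coeff_one, coeff_X]
  rw [Finset.sum_eq_zero this]
  simp [coeff_one]
  ring

/-- A polynomial `G` with `(1 - z) f - G` of high order at `0` is the numerator of a Padé
approximant of `f` with denominator `1 - z`. -/
lemma isPade_and_mem_Nset_of_isBigO {f : ℂ → ℂ} (hf : AnalyticAt ℂ f 0) {G : ℂ[X]} {m : ℕ}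
    (hm : G.natDegree ≤ m) (h1 : G.eval 1 ≠ 0)
    (h : (fun z => (1 - z) * f z - G.eval z) =O[𝓝 0] fun z => z ^ (m + 2)) :
    tc f ∈ Nset m 1 ∧ IsPade (tc f) m 1 G (1 - X) := by
  have hco : ∀ j < m + 2, ∑ i ∈ range (j + 1), (1 - X : ℂ[X]).coeff i * tc f (j - i) = G.coeff j :=
    fun j hj => sum_coeff_mul_tc_of_isBigO hf (by simpa using h) hj
  have hP : IsPade (tc f) m 1 G (1 - X) := by
    refine ⟨hm, natDegree_le_of_degree_le degree_one_sub_X.le, ?_, coeff_one_sub_X_zero,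
      fun j hj => hco j (by omega)⟩
    rw [← neg_sub, IsCoprime.neg_right_iff, isCoprime_comm, ← C_1,
      (irreducible_X_sub_C (1 : ℂ)).coprime_iff_not_dvd, dvd_iff_isRoot]
    exact h1
  have hsum : ∀ j < m + 2, tc f j = ∑ i ∈ range (j + 1), G.coeff i := by
    intro j
    induction j with
    | zero => intro hj; simpa using hco 0 hj
    | succ j ih =>
      intro hj
      rw [Finset.sum_range_succ, ← ih (by omega), ← hco (j + 1) hj, sum_one_sub_X_coeff_mul]
      ring
  refine ⟨⟨?_, G, 1 - X, hP, by rw [degree_one_sub_X]; rfl⟩, hP⟩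
  have e : hankelDet (tc f) m 1 = tc f m := by
    simp [hankelDet, acoefZ]
  rw [e, hsum m (by omega)]
  rw [eval_eq_sum_range' (Nat.lt_succ_of_le hm)] at h1
  simpa using h1

end Pade

/-- The value of a correction polynomial can be prescribed on an admissible set while keeping it
small on a disc. -/
lemma IsAdmissible.exists_correction {K : Set ℂ} (hK : IsAdmissible K) (G p : ℂ[X]) (N : ℕ)
    {r : ℝ} (hr : r < 1) {ε : ℝ} (hε : 0 < ε) :
    ∃ q : ℂ[X], (∀ z ∈ closedBall (0 : ℂ) r, ‖q.eval z‖ ≤ ε) ∧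
      (∀ z ∈ K, ‖(G + X ^ N * q).eval z / (1 - z) - p.eval z‖ ≤ ε) ∧
      (G + X ^ N * q).eval 1 ≠ 0 := by
  have hK0 : ∀ z ∈ K, z ∉ ball (0 : ℂ) 1 := fun z hz h =>
    Set.disjoint_left.1 hK.2.1 hz (Or.inl h)
  have hK1 : ∀ z ∈ K, 1 - z ≠ 0 := fun z hz h =>
    Set.disjoint_left.1 hK.2.1 hz (Or.inr (sub_eq_zero.1 h).symm)
  have hKz : ∀ z ∈ K, z ≠ 0 := fun z hz h => hK0 z hz (h ▸ mem_ball_self one_pos)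
  have hKr : ∀ z ∈ K, z ∉ closedBall (0 : ℂ) r := fun z hz h =>
    hK0 z hz (closedBall_subset_ball hr h)
  set φ : ℂ → ℂ := (closedBall (0 : ℂ) r)ᶜ.indicator
    fun z => ((1 - z) * p.eval z - G.eval z) / z ^ N with hφ
  have hφ0 : ∀ z ∈ closedBall (0 : ℂ) r, φ z = 0 := fun z hz =>
    Set.indicator_of_notMem (Set.notMem_compl_iff.2 hz) _
  have hφd : DifferentiableOn ℂ φ (K ∪ closedBall 0 r) := by
    intro z hz
    rcases hz with hz | hz
    · have h1 : (closedBall (0 : ℂ) r)ᶜ ∈ 𝓝 z := isClosed_closedBall.isOpen_compl.mem_nhds (hKr z hz)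
      have h2 : DifferentiableAt ℂ (fun z => ((1 - z) * p.eval z - G.eval z) / z ^ N) z := by
        refine DifferentiableAt.div ?_ (by fun_prop) (pow_ne_zero _ (hKz z hz))
        exact (((differentiableAt_const _).sub differentiableAt_id).mul p.differentiableAt).sub
          G.differentiableAt
      refine (h2.congr_of_eventuallyEq ?_).differentiableWithinAt
      filter_upwards [h1] with w hw
      exact Set.indicator_of_mem hw _
    · have h1 : Kᶜ ∈ 𝓝 z := hK.1.isClosed.isOpen_compl.mem_nhds fun h => hKr z h hz
      refine (differentiableWithinAt_const (0 : ℂ)).congr_of_eventuallyEq ?_ ?_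
      · filter_upwards [nhdsWithin_le_nhds h1, self_mem_nhdsWithin] with w hw hw'
        exact hφ0 w (hw'.resolve_left hw)
      · exact hφ0 z hz
  obtain ⟨M, hM⟩ : ∃ M, ∀ z ∈ K, ‖z ^ N / (1 - z)‖ ≤ M :=
    hK.1.exists_bound_of_continuousOn ((continuous_pow N).continuousOn.div (by fun_prop) hK1)
  set η := ε / (2 * (|M| + 1)) with hη
  have hη0 : 0 < η := by positivity
  have hηε : 2 * η * (|M| + 1) = ε := by rw [hη]; field_simp
  obtain ⟨p₀, hp₀⟩ := exists_polynomial_norm_sub_lt (hK.1.union (isCompact_closedBall 0 r))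
    (hK.isPreconnected_compl_union hr) hφd.continuousOn (hφd.mono interior_subset) hη0
  obtain ⟨c, hc, hc1⟩ : ∃ c : ℂ, ‖c‖ ≤ η ∧ (G + X ^ N * (p₀ + C c)).eval 1 ≠ 0 := by
    by_cases h : (G + X ^ N * p₀).eval 1 = 0
    · refine ⟨η, by simp [abs_of_pos hη0], ?_⟩
      have : (G + X ^ N * (p₀ + C (η : ℂ))).eval 1 =
          (G + X ^ N * p₀).eval 1 + (η : ℂ) := by
        simp; ring
      rw [this, h, zero_add]
      exact_mod_cast hη0.ne'
    · exact ⟨0, by simpa using hη0.le, by simpa using h⟩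
  have hq : ∀ z ∈ K ∪ closedBall 0 r, ‖(p₀ + C c).eval z - φ z‖ ≤ 2 * η := by
    intro z hz
    have e : (p₀ + C c).eval z - φ z = (p₀.eval z - φ z) + c := by simp; ring
    rw [e]
    linarith [norm_add_le (p₀.eval z - φ z) c, hp₀ z hz]
  have hηε' : 2 * η ≤ ε := by nlinarith [abs_nonneg M]
  refine ⟨p₀ + C c, fun z hz => ?_, fun z hz => ?_, hc1⟩
  · have h1 := hq z (Or.inr hz)
    rw [hφ0 z hz, sub_zero] at h1
    exact h1.trans hηε'
  · have h1 := hq z (Or.inl hz)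
    have h2 : φ z = ((1 - z) * p.eval z - G.eval z) / z ^ N := Set.indicator_of_mem (hKr z hz) _
    have h3 := hK1 z hz
    have h4 : z ^ N ≠ 0 := pow_ne_zero _ (hKz z hz)
    have e : (G + X ^ N * (p₀ + C c)).eval z / (1 - z) - p.eval z =
        z ^ N / (1 - z) * ((p₀ + C c).eval z - φ z) := by
      rw [h2, eval_add, eval_mul, eval_pow, eval_X]
      field_simp
      ring
    rw [e, norm_mul, ← hηε, mul_comm]
    gcongr
    linarith [hM z hz, le_abs_self M]

lemma exists_gt_index {μ : ℕ → ℕ} (hμub : ∀ N : ℕ, ∃ k, N < μ k) (i N : ℕ) :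
    ∃ k, i < k ∧ N < μ k := by
  obtain ⟨k, hk⟩ := hμub (N + ∑ j ∈ range (i + 1), μ j)
  refine ⟨k, ?_, by omega⟩
  by_contra hcon
  have := Finset.single_le_sum (f := μ) (fun _ _ => Nat.zero_le _)
    (Finset.mem_range.2 (show k < i + 1 by omega))
  omega

lemma exists_correction_seq {μ : ℕ → ℕ} (hμub : ∀ N : ℕ, ∃ k, N < μ k)
    {T : ℕ → Set ℂ × ℂ[X]} (hT : ∀ n, IsAdmissible (T n).1) (G₀ : ℂ[X]) {r ε : ℕ → ℝ}
    (hr : ∀ k, r k < 1) (hε : ∀ k, 0 < ε k) :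
    ∃ (G : ℕ → ℂ[X]) (i : ℕ → ℕ), G 0 = G₀ ∧ StrictMono i ∧ StrictMono (μ ∘ i) ∧
      (∀ k, (G k).natDegree ≤ μ (i k)) ∧
      (∀ k, ∀ z ∈ closedBall (0 : ℂ) (r k),
        ‖(G (k + 1)).eval z - (G k).eval z‖ ≤ ε k * ‖z‖ ^ (μ (i k) + 2)) ∧
      (∀ k, ∀ z ∈ (T k).1, ‖(G (k + 1)).eval z / (1 - z) - (T k).2.eval z‖ ≤ ε k) ∧
      ∀ k, (G (k + 1)).eval 1 ≠ 0 := by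
  let S := {s : ℂ[X] × ℕ // s.1.natDegree ≤ μ s.2}
  have hstep : ∀ (k : ℕ) (s : S), ∃ s' : S, s.1.2 < s'.1.2 ∧ μ s.1.2 < μ s'.1.2 ∧
      (∀ z ∈ closedBall (0 : ℂ) (r k),
        ‖s'.1.1.eval z - s.1.1.eval z‖ ≤ ε k * ‖z‖ ^ (μ s.1.2 + 2)) ∧
      (∀ z ∈ (T k).1, ‖s'.1.1.eval z / (1 - z) - (T k).2.eval z‖ ≤ ε k) ∧
      s'.1.1.eval 1 ≠ 0 := by
    rintro k ⟨⟨G, i⟩, hG⟩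
    obtain ⟨q, hq1, hq2, hq3⟩ := (hT k).exists_correction G (T k).2 (μ i + 2) (hr k) (hε k)
    obtain ⟨j, hij, hj⟩ := exists_gt_index hμub i (max (μ i) (G + X ^ (μ i + 2) * q).natDegree)
    refine ⟨⟨⟨G + X ^ (μ i + 2) * q, j⟩, (le_max_right _ _).trans hj.le⟩, hij,
      (le_max_left _ _).trans_lt hj, fun z hz => ?_, hq2, hq3⟩
    simp only [eval_add, eval_mul, eval_pow, eval_X, add_sub_cancel_left, norm_mul, norm_pow]
    rw [mul_comm]
    exact mul_le_mul_of_nonneg_right (hq1 z hz) (by positivity)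
  choose next hnext using hstep
  obtain ⟨i₀, hi₀⟩ := hμub G₀.natDegree
  let s : ℕ → S := fun n => Nat.rec ⟨(G₀, i₀), hi₀.le⟩ next n
  refine ⟨fun k => (s k).1.1, fun k => (s k).1.2, rfl, strictMono_nat_of_lt_succ fun k => ?_,
    strictMono_nat_of_lt_succ fun k => ?_, fun k => (s k).2, fun k => ?_, fun k => ?_, fun k => ?_⟩
  · exact (hnext k (s k)).1
  · exact (hnext k (s k)).2.1
  · exact (hnext k (s k)).2.2.1
  · exact (hnext k (s k)).2.2.2.1
  · exact (hnext k (s k)).2.2.2.2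

/-- The limit of a sequence of polynomials with rapidly decreasing increments on discs exhausting
the unit disc. -/
lemma exists_limit_of_norm_sub_le {G : ℕ → ℂ[X]} {m : ℕ → ℕ} (hm : Monotone m) {r : ℕ → ℝ}
    (hr : Monotone r) (hr1 : ∀ k, r k < 1) (hrt : ∀ x < 1, ∃ k, x ≤ r k) {ε₀ : ℝ} (hε₀ : 0 < ε₀)
    (hG : ∀ k, ∀ z ∈ closedBall (0 : ℂ) (r k),
      ‖(G (k + 1)).eval z - (G k).eval z‖ ≤ ε₀ / 2 ^ k * ‖z‖ ^ (m k + 2)) :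
    ∃ g : ℂ → ℂ, ∀ k, ∀ z ∈ closedBall (0 : ℂ) (r k),
      ‖g z - (G k).eval z‖ ≤ 2 * (ε₀ / 2 ^ k) * ‖z‖ ^ (m k + 2) := by
  have hd : ∀ k, ∀ z ∈ closedBall (0 : ℂ) (r k), ∀ n,
      dist ((G (n + k)).eval z) ((G (n + 1 + k)).eval z) ≤
        2 * (ε₀ / 2 ^ k) * ‖z‖ ^ (m k + 2) / 2 / 2 ^ n := by
    intro k z hz n
    have h1 := hG (n + k) z (closedBall_subset_closedBall (hr (Nat.le_add_left k n)) hz)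
    have hz1 : ‖z‖ ≤ 1 := (mem_closedBall_zero_iff.1 hz).trans (hr1 k).le
    have h2 : ‖z‖ ^ (m (n + k) + 2) ≤ ‖z‖ ^ (m k + 2) :=
      pow_le_pow_of_le_one (norm_nonneg z) hz1
        (Nat.add_le_add_right (hm (Nat.le_add_left k n)) 2)
    rw [dist_comm, dist_eq_norm, show n + 1 + k = n + k + 1 by ring]
    refine h1.trans ((mul_le_mul_of_nonneg_left h2 (by positivity)).trans (le_of_eq ?_))
    rw [pow_add]
    field_simp
  have hex : ∀ z : ℂ, ∃ l, ‖z‖ < 1 → Tendsto (fun n => (G n).eval z) atTop (𝓝 l) := by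
    intro z
    by_cases hz : ‖z‖ < 1
    · obtain ⟨k, hk⟩ := hrt _ hz
      obtain ⟨l, hl⟩ := cauchySeq_tendsto_of_complete
        (cauchySeq_of_le_geometric_two (hd k z (mem_closedBall_zero_iff.2 hk)))
      exact ⟨l, fun _ => (tendsto_add_atTop_iff_nat k).1 hl⟩
    · exact ⟨0, fun h => absurd h hz⟩
  choose g hg using hex
  refine ⟨g, fun k z hz => ?_⟩
  have h1 := (tendsto_add_atTop_iff_nat k).2
    (hg z ((mem_closedBall_zero_iff.1 hz).trans_lt (hr1 k)))
  have h2 := dist_le_of_le_geometric_two_of_tendsto (hd k z hz) h1 0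
  rw [dist_comm, dist_eq_norm] at h2
  simpa using h2

lemma exists_mem_UQset {μ : ℕ → ℕ} (hμub : ∀ N : ℕ, ∃ k, N < μ k) (G₀ : ℂ[X]) {r₀ ε₀ : ℝ}
    (hr₀ : r₀ < 1) (hε₀ : 0 < ε₀) :
    ∃ f ∈ UQset μ 1 (1 - X) {1}, ∀ z ∈ closedBall (0 : ℂ) r₀,
      ‖f.1 z - G₀.eval z / (1 - z)‖ ≤ 2 * ε₀ / (1 - r₀) := by
  obtain ⟨T, hT, hTK⟩ := exists_seq_targets
  set r : ℕ → ℝ := fun k => max r₀ (1 - 1 / (k + 1)) with hrdef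
  have hr1 : ∀ k, r k < 1 := fun k => max_lt hr₀ (by
    have : (0 : ℝ) < 1 / (k + 1) := by positivity
    linarith)
  have hrm : Monotone r := fun a b hab => max_le_max le_rfl (by
    have : (1 : ℝ) / (b + 1) ≤ 1 / (a + 1) := by gcongr
    linarith)
  have hrt : ∀ x < 1, ∃ k, x ≤ r k := by
    intro x hx
    obtain ⟨k, hk⟩ := exists_nat_one_div_lt (sub_pos.2 hx)
    exact ⟨k, le_max_of_le_right (by linarith)⟩
  obtain ⟨G, i, hG0, hi, hμi, hdeg, hGr, hGT, hG1⟩ := exists_correction_seq hμub hT G₀ hr1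
    (ε := fun k => ε₀ / 2 ^ k) (fun k => by positivity)
  obtain ⟨g, hg⟩ := exists_limit_of_norm_sub_le hμi.monotone hrm hr1 hrt hε₀ hGr
  have hε2 : Tendsto (fun k : ℕ => ε₀ / 2 ^ k) atTop (𝓝 0) := by
    have := (tendsto_pow_atTop_nhds_zero_of_lt_one (r := (1 / 2 : ℝ)) (by norm_num)
      (by norm_num)).const_mul ε₀
    rw [mul_zero] at this
    refine this.congr fun k => ?_
    rw [one_div, inv_pow, div_eq_mul_inv]
  set f : ℂ → ℂ := unitD.indicator fun z => g z / (1 - z) with hf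
  have hfz : ∀ z ∈ unitD, f z = g z / (1 - z) := fun z hz => Set.indicator_of_mem hz _
  have hest : ∀ k, ∀ ρ ≤ r k, ∀ z ∈ closedBall (0 : ℂ) ρ,
      ‖f z - (G k).eval z / (1 - z)‖ ≤ 2 * (ε₀ / 2 ^ k) / (1 - ρ) := by
    intro k ρ hρ z hz
    have hzρ := mem_closedBall_zero_iff.1 hz
    have hz1 : ‖z‖ < 1 := (hzρ.trans hρ).trans_lt (hr1 k)
    have h1 := hg k z (mem_closedBall_zero_iff.2 (hzρ.trans hρ))
    have h2 : 1 - ρ ≤ ‖1 - z‖ := by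
      have := norm_sub_norm_le (1 : ℂ) z
      rw [norm_one] at this
      linarith
    have h3 : ‖g z - (G k).eval z‖ ≤ 2 * (ε₀ / 2 ^ k) :=
      h1.trans (mul_le_of_le_one_right (by positivity) (pow_le_one₀ (norm_nonneg _) hz1.le))
    rw [hfz z (mem_ball_zero_iff.2 hz1), ← sub_div, norm_div]
    exact div_le_div₀ (by positivity) h3 (sub_pos.2 (hρ.trans_lt (hr1 k))) h2
  have hloc : TendstoLocallyUniformlyOn (fun k z => (G k).eval z / (1 - z)) f atTop unitD := by
    rw [Metric.tendstoLocallyUniformlyOn_iff]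
    intro η hη z hz
    obtain ⟨ρ, hzρ, hρ1⟩ := exists_between (mem_ball_zero_iff.1 hz)
    obtain ⟨k, hk⟩ := hrt ρ hρ1
    refine ⟨closedBall 0 ρ, nhdsWithin_le_nhds (mem_of_superset
      (isOpen_ball.mem_nhds (mem_ball_zero_iff.2 hzρ)) ball_subset_closedBall), ?_⟩
    have h0 : Tendsto (fun n : ℕ => 2 * (ε₀ / 2 ^ n) / (1 - ρ)) atTop (𝓝 0) := by
      simpa using (hε2.const_mul 2).div_const (1 - ρ)
    filter_upwards [h0.eventually (gt_mem_nhds hη), eventually_ge_atTop k] with n hn hkn y hy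
    rw [dist_eq_norm]
    exact (hest n ρ (hk.trans (hrm hkn)) y hy).trans_lt hn
  have h1z : ∀ z ∈ unitD, 1 - z ≠ 0 := fun z hz h => by
    rw [← sub_eq_zero.1 h] at hz
    simp [unitD] at hz
  have hfd : DifferentiableOn ℂ f unitD :=
    hloc.differentiableOn (Eventually.of_forall fun k =>
      (G k).differentiableOn.div (by fun_prop) h1z) isOpen_ball
  have hfa : AnalyticAt ℂ f 0 := hfd.analyticAt (isOpen_ball.mem_nhds (mem_ball_self one_pos))
  have hev : ∀ z : ℂ, (1 - X : ℂ[X]).eval z = 1 - z := fun z => by simp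
  have hpade : ∀ k, tc f ∈ Nset (μ (i (k + 1))) 1 ∧
      IsPade (tc f) (μ (i (k + 1))) 1 (G (k + 1)) (1 - X) := by
    intro k
    refine isPade_and_mem_Nset_of_isBigO hfa (hdeg _) (hG1 k)
      (Asymptotics.IsBigO.of_bound (2 * (ε₀ / 2 ^ (k + 1))) ?_)
    have hrk : 0 < r (k + 1) := lt_max_of_lt_right (by
      have : (1 : ℝ) / ((k + 1 : ℕ) + 1) < 1 := by
        rw [div_lt_one (by positivity)]
        push_cast
        linarith [(Nat.cast_nonneg k : (0 : ℝ) ≤ k)]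
      linarith)
    filter_upwards [closedBall_mem_nhds (0 : ℂ) hrk] with z hz
    have hz1 : z ∈ unitD := closedBall_subset_ball (hr1 _) hz
    rw [hfz z hz1, mul_div_cancel₀ _ (h1z z hz1), norm_pow]
    exact hg (k + 1) z hz
  refine ⟨⟨f, hfd, fun z hz => Set.indicator_of_notMem hz _⟩, ?_, fun z hz => ?_⟩
  · intro K hKc hKd hKconn h hhc hhd
    have hK : IsAdmissible K := ⟨hKc, hKd, hKconn.isPreconnected⟩
    obtain ⟨φ, hφ, hφT⟩ := extraction_forall_of_frequently
      (P := fun j n => K ⊆ (T n).1 ∧ ∀ z ∈ K, ‖(T n).2.eval z - h z‖ < 1 / (j + 1))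
      (fun j => frequently_atTop.2 fun N =>
        hTK K hK h hhc hhd _ Nat.one_div_pos_of_nat N)
    refine ⟨fun j => i (φ j + 1), fun a b hab => hi (Nat.succ_lt_succ (hφ hab)),
      fun j => G (φ j + 1), fun j => hpade (φ j), ?_, ?_⟩
    · rw [Metric.tendstoUniformlyOn_iff]
      intro η hη
      have h0 : Tendsto (fun j : ℕ => ε₀ / 2 ^ φ j + 1 / ((j : ℝ) + 1)) atTop (𝓝 0) := by
        simpa using (hε2.comp hφ.tendsto_atTop).add tendsto_one_div_add_atTop_nhds_zero_nat
      filter_upwards [h0.eventually (gt_mem_nhds hη)] with j hj z hz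
      have h1 := hGT (φ j) z ((hφT j).1 hz)
      have h2 := (hφT j).2 z hz
      have h3 := norm_sub_le_norm_sub_add_norm_sub ((G (φ j + 1)).eval z / (1 - z))
        ((T (φ j)).2.eval z) (h z)
      rw [dist_comm, dist_eq_norm, hev]
      linarith
    · intro u hu x hx
      obtain ⟨t, ht, hev'⟩ := hloc u hu x hx
      refine ⟨t, ht, ?_⟩
      simp only [hev]
      exact ((tendsto_add_atTop_nat 1).comp hφ.tendsto_atTop).eventually hev'
  · have := hest 0 r₀ (le_max_left _ _) z hz
    rw [hG0] at this
    simpa using this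

lemma directedOn_isCompact {α : Type*} [TopologicalSpace α] :
    DirectedOn (· ⊆ ·) {K : Set α | IsCompact K} :=
  fun A hA B hB => ⟨A ∪ B, IsCompact.union hA hB, Set.subset_union_left, Set.subset_union_right⟩

lemma hasBasis_nhds_hol {Ω : Set ℂ} (f₀ : Hol Ω) :
    (𝓝 f₀).HasBasis (fun s : Set Ω × ℝ => IsCompact s.1 ∧ 0 < s.2)
      fun s => {f | ∀ z ∈ s.1, ‖f.1 z - f₀.1 z‖ < s.2} := by
  have h := (UniformOnFun.hasBasis_nhds_of_basis Ω ℂ {K : Set Ω | IsCompact K}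
    (UniformOnFun.ofFun {K : Set Ω | IsCompact K} fun z : Ω => f₀.1 z) ⟨∅, isCompact_empty⟩
    directedOn_isCompact Metric.uniformity_basis_dist).comap
    (fun f : Hol Ω => UniformOnFun.ofFun {K : Set Ω | IsCompact K} fun z : Ω => f.1 z)
  rw [← nhds_induced] at h
  refine h.congr (fun _ => Iff.rfl) fun s _ => ?_
  ext f
  simp [UniformOnFun.gen, dist_eq_norm]

lemma norm_sub_lt_mem_nhds_hol (f₀ : Hol unitD) {r ε : ℝ} (hr : r < 1) (hε : 0 < ε) :
    {f : Hol unitD | ∀ z ∈ closedBall (0 : ℂ) r, ‖f.1 z - f₀.1 z‖ < ε} ∈ 𝓝 f₀ := by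
  have hc : IsCompact ((↑) ⁻¹' closedBall (0 : ℂ) r : Set unitD) := by
    refine Subtype.isCompact_iff.2 ?_
    rw [Subtype.image_preimage_coe, unitD, Set.inter_eq_right.2 (closedBall_subset_ball hr)]
    exact isCompact_closedBall 0 r
  refine mem_of_superset ((hasBasis_nhds_hol f₀).mem_of_mem (i := (_, ε)) ⟨hc, hε⟩) ?_
  exact fun f hf z hz => hf ⟨z, closedBall_subset_ball hr hz⟩ hz

lemma exists_norm_sub_lt_subset_of_mem_nhds_hol {f₀ : Hol unitD} {W : Set (Hol unitD)}
    (hW : W ∈ 𝓝 f₀) : ∃ r, 0 ≤ r ∧ r < 1 ∧ ∃ ε > 0,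
      {f : Hol unitD | ∀ z ∈ closedBall (0 : ℂ) r, ‖f.1 z - f₀.1 z‖ < ε} ⊆ W := by
  obtain ⟨⟨K, ε⟩, ⟨hK, hε⟩, hKW⟩ := (hasBasis_nhds_hol f₀).mem_iff.1 hW
  obtain ⟨r, ⟨hr0, hr⟩, hKr⟩ := exists_pos_lt_subset_ball one_pos
    (hK.image continuous_subtype_val).isClosed
    (fun z ⟨w, _, hw⟩ => hw ▸ w.2 : ((↑) '' K : Set ℂ) ⊆ ball (0 : ℂ) 1)
  exact ⟨r, hr0.le, hr, ε, hε, fun f hf => hKW fun z hz =>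
    hf z (ball_subset_closedBall (hKr ⟨z, hz, rfl⟩))⟩

lemma analyticAt_zero_hol (f : Hol unitD) : AnalyticAt ℂ f.1 0 :=
  f.2.1.analyticAt (isOpen_ball.mem_nhds (mem_ball_self one_pos))

lemma tc_sub {f g : ℂ → ℂ} (hf : AnalyticAt ℂ f 0) (hg : AnalyticAt ℂ g 0) (k : ℕ) :
    tc (f - g) k = tc f k - tc g k := by
  rw [tc, iteratedDeriv_sub hf.contDiffAt hg.contDiffAt, sub_div, tc, tc]

lemma tc_add {f g : ℂ → ℂ} (hf : AnalyticAt ℂ f 0) (hg : AnalyticAt ℂ g 0) (k : ℕ) :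
    tc (f + g) k = tc f k + tc g k := by
  rw [tc, iteratedDeriv_add hf.contDiffAt hg.contDiffAt, add_div, tc, tc]

lemma tc_of_eventuallyEq_eval {f : ℂ → ℂ} {p : ℂ[X]} (h : f =ᶠ[𝓝 0] fun z => p.eval z) (k : ℕ) :
    tc f k = p.coeff k := by
  have hf : AnalyticAt ℂ f 0 :=
    (analyticAt_congr h).2 (p.differentiable.analyticAt 0)
  have := sum_coeff_mul_tc_of_isBigO hf (G := p) (Q := 1) (n := k + 1) (j := k) ?_ k.lt_succ_self
  · rw [← this, Finset.sum_range_succ']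
    simp [coeff_one]
  · refine Asymptotics.IsBigO.of_bound 0 ?_
    filter_upwards [h] with z hz
    simp [hz]

lemma continuous_tc_hol (k : ℕ) : Continuous fun f : Hol unitD => tc f.1 k := by
  refine continuous_iff_continuousAt.2 fun f₀ => Metric.tendsto_nhds.2 fun η hη => ?_
  have hε : 0 < η / 2 * (1 / 2 : ℝ) ^ k := by positivity
  filter_upwards [norm_sub_lt_mem_nhds_hol f₀ one_half_lt_one hε] with f hf
  have hd : DifferentiableOn ℂ (f.1 - f₀.1) (closedBall 0 (1 / 2)) :=
    (f.2.1.sub f₀.2.1).mono (closedBall_subset_ball one_half_lt_one)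
  have h := Complex.norm_iteratedDeriv_le_of_forall_mem_sphere_norm_le k one_half_pos
    (hd.diffContOnCl_ball subset_rfl) fun z hz => (hf z (sphere_subset_closedBall hz)).le
  rw [dist_eq_norm, ← tc_sub (analyticAt_zero_hol f) (analyticAt_zero_hol f₀), tc, norm_div,
    Complex.norm_natCast, div_lt_iff₀ (by positivity)]
  refine h.trans_lt ?_
  have : (0 : ℝ) < k.factorial := by positivity
  rw [mul_div_assoc, mul_div_cancel_right₀ _ (by positivity), mul_comm]
  gcongr
  exact half_lt_self hη

lemma isNowhereDense_tc_succ_eq (m : ℕ) :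
    IsNowhereDense {f : Hol unitD | tc f.1 (m + 1) = tc f.1 m} := by
  rw [(isClosed_eq (continuous_tc_hol _) (continuous_tc_hol _)).isNowhereDense_iff,
    Set.eq_empty_iff_forall_notMem]
  intro f₀ hf₀
  obtain ⟨r, -, hr, ε, hε, hW⟩ :=
    exists_norm_sub_lt_subset_of_mem_nhds_hol (mem_interior_iff_mem_nhds.1 hf₀)
  set p : ℂ[X] := C ((ε / 2 : ℝ) : ℂ) * X ^ m with hp
  set g : Hol unitD := ⟨unitD.indicator fun z => p.eval z,
    p.differentiable.differentiableOn.congr fun z hz => Set.indicator_of_mem hz _,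
    fun z hz => Set.indicator_of_notMem hz _⟩ with hg
  have hgd : ∀ z ∈ unitD, g.1 z = p.eval z := fun z hz =>
    Set.indicator_of_mem (f := fun z => p.eval z) hz
  have hgp : g.1 =ᶠ[𝓝 0] fun z => p.eval z := by
    filter_upwards [ball_mem_nhds (0 : ℂ) one_pos] with z hz
    exact hgd z hz
  have h0 : tc f₀.1 (m + 1) = tc f₀.1 m :=
    (interior_subset hf₀ : f₀ ∈ {f : Hol unitD | tc f.1 (m + 1) = tc f.1 m})
  have h1 : tc (f₀ + g).1 (m + 1) = tc (f₀ + g).1 m := by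
    refine hW fun z hz => ?_
    have e : (f₀ + g).1 z - f₀.1 z = p.eval z := by
      rw [Submodule.coe_add, Pi.add_apply, add_sub_cancel_left]
      exact hgd z (closedBall_subset_ball hr hz)
    rw [e, hp, eval_mul, eval_C, eval_pow, eval_X, norm_mul, norm_pow, Complex.norm_real,
      Real.norm_of_nonneg (by positivity)]
    have : ‖z‖ ^ m ≤ 1 := pow_le_one₀ (norm_nonneg z)
      ((mem_closedBall_zero_iff.1 hz).trans hr.le)
    nlinarith
  rw [Submodule.coe_add, tc_add (analyticAt_zero_hol f₀) (analyticAt_zero_hol g),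
    tc_add (analyticAt_zero_hol f₀) (analyticAt_zero_hol g), h0, add_right_inj,
    tc_of_eventuallyEq_eval hgp, tc_of_eventuallyEq_eval hgp] at h1
  simp [hp, coeff_X_pow] at h1
  exact hε.ne' (by exact_mod_cast (by linear_combination -2 * h1 : (ε : ℂ) = 0))

lemma isMeagre_UQset (μ : ℕ → ℕ) : IsMeagre (UQset μ 1 (1 - X) {1}) := by
  refine IsMeagre.mono ?_ (isMeagre_iUnion fun m => (isNowhereDense_tc_succ_eq m).isMeagre)
  intro f hf
  obtain ⟨σ, -, P, hP, -⟩ := hf ∅ isCompact_empty (Set.empty_disjoint _)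
    (by simpa using isConnected_univ) 0 (continuousOn_empty _) (by simp)
  obtain ⟨hdeg, -, -, -, hj⟩ := (hP 0).2
  have h := hj (μ (σ 0) + 1) le_rfl
  rw [sum_one_sub_X_coeff_mul, coeff_eq_zero_of_natDegree_lt (by omega), sub_eq_zero] at h
  exact Set.mem_iUnion.2 ⟨μ (σ 0), h⟩

lemma dense_UQset {μ : ℕ → ℕ} (hμub : ∀ N : ℕ, ∃ k, N < μ k) :
    Dense (UQset μ 1 (1 - X) {1}) := by
  intro f₀
  refine mem_closure_iff_nhds.2 fun W hW => ?_
  obtain ⟨r, hr0, hr, ε, hε, hsub⟩ := exists_norm_sub_lt_subset_of_mem_nhds_hol hW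
  have hr1 : 0 < 1 - r := sub_pos.2 hr
  have hK : IsPreconnected (closedBall (0 : ℂ) r)ᶜ := by
    convert isPreconnected_norm_mem (Set.ordConnected_Ioi (a := r)) using 1
    ext z
    simp
  have hd : DifferentiableOn ℂ (fun z => (1 - z) * f₀.1 z) (closedBall (0 : ℂ) r) :=
    ((differentiableOn_const 1).sub differentiableOn_id).mul
      (f₀.2.1.mono (closedBall_subset_ball hr))
  obtain ⟨G, hG⟩ := exists_polynomial_norm_sub_lt (isCompact_closedBall 0 r) hK
    hd.continuousOn (hd.mono interior_subset) (ε := ε * (1 - r) / 2) (by positivity)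
  obtain ⟨f, hf, hfG⟩ := exists_mem_UQset hμub G hr (ε₀ := ε * (1 - r) / 8) (by positivity)
  refine ⟨f, hsub fun z hz => ?_, hf⟩
  have hz1 : 1 - r ≤ ‖1 - z‖ := by
    have := norm_sub_norm_le 1 z
    have := mem_closedBall_zero_iff.1 hz
    rw [norm_one] at *
    linarith
  have hz0 : 1 - z ≠ 0 := norm_pos_iff.1 (hr1.trans_le hz1)
  have h1 : ‖G.eval z / (1 - z) - f₀.1 z‖ < ε / 2 := by
    have e : G.eval z / (1 - z) - f₀.1 z = (G.eval z - (1 - z) * f₀.1 z) / (1 - z) := by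
      field_simp
    rw [e, norm_div, div_lt_iff₀ (hr1.trans_le hz1)]
    calc _ < ε * (1 - r) / 2 := hG z hz
      _ = ε / 2 * (1 - r) := by ring
      _ ≤ _ := by gcongr
  have h2 : 2 * (ε * (1 - r) / 8) / (1 - r) = ε / 4 := by
    field_simp
    norm_num
  have h3 := hfG z hz
  rw [h2] at h3
  linarith [norm_sub_le_norm_sub_add_norm_sub (f.1 z) (G.eval z / (1 - z)) (f₀.1 z)]

/-- Theorem 4.1 : for an unbounded sequence `μ = (p_n)` of positive integers, the set
`𝒰_{1-z}^μ(𝔻)` of Padé universal series whose Padé denominators `Q_{λ_n,1}(f)` equal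
`1 - z` is a dense and meagre subset of `H(𝔻)`; in particular it is nonempty. -/
theorem stmt_9 (μ : ℕ → ℕ) (hμpos : ∀ k, 0 < μ k) (hμub : ∀ N : ℕ, ∃ k, N < μ k) :
    Dense (UQset μ 1 (1 - Polynomial.X) {1}) ∧
    IsMeagre (UQset μ 1 (1 - Polynomial.X) {1}) ∧
    ∃ f : Hol unitD, f ∈ UQset μ 1 (1 - Polynomial.X) {1} := by
  obtain ⟨f, hf, -⟩ := exists_mem_UQset hμub 0 (r₀ := 0) (ε₀ := 1) one_pos one_pos
  exact ⟨dense_UQset hμub, isMeagre_UQset μ, f, hf⟩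

end
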